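/- arXiv:2307.13680 — 8 statements merged into one kernel-verified Lean document; each statement's English description precedes it below -/
import Mathlib

section
/- Let (Ω, 𝔉, ℙ) be a probability space with a filtration 𝔉_0 ⊆ 𝔉_1 ⊆ … ⊆ 𝔉_n, and let ξ_1,…,ξ_n be real-valued random variables with ξ_k measurable with respect to 𝔉_k. Let b > 0 and suppose |ξ_k − E[ξ_k | 𝔉_{k−1}]| ≤ b almost surely for every k = 1,…,n. Let σ_n² = Σ_{k=1}^n E[(ξ_k − E[ξ_k | 𝔉_{k−1}])² | 𝔉_{k−1}] denote the conditional variance. Then for every ρ ∈ (0,1] and every δ ∈ (0,1), with probability at least 1 − δ, Σ_{k=1}^n ξ_k − Σ_{k=1}^n E[ξ_k | 𝔉_{k−1}] ≤ ρ·σ_n²/b + b·log(1/δ)/ρ. -/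
open MeasureTheory

lemma step_aux {Ω : Type*} {m : MeasurableSpace Ω} (ℙ : Measure Ω) [IsProbabilityMeasure ℙ]
    (F : MeasurableSpace Ω) (hF : F ≤ m) (X L : Ω → ℝ) (hX : Integrable X ℙ)
    (b c C : ℝ) (hb : 0 < b) (hc : 0 < c) (hcb : c * b ≤ 1)
    (hXb : ∀ᵐ ω ∂ℙ, |X ω| ≤ b) (hX0 : ℙ[X | F] =ᵐ[ℙ] 0)
    (hL : StronglyMeasurable[F] L) (hL0 : ∀ ω, 0 ≤ L ω) (hLC : ∀ᵐ ω ∂ℙ, L ω ≤ C) :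
    (∫ ω, L ω * Real.exp (c * X ω - c ^ 2 * (ℙ[fun ω' => X ω' ^ 2 | F]) ω) ∂ℙ ≤ ∫ ω, L ω ∂ℙ) ∧
    ∀ᵐ ω ∂ℙ, L ω * Real.exp (c * X ω - c ^ 2 * (ℙ[fun ω' => X ω' ^ 2 | F]) ω)
      ≤ C * Real.exp 1 := by
  set V : Ω → ℝ := ℙ[fun ω' => X ω' ^ 2 | F] with hV
  have hV0 : ∀ᵐ ω ∂ℙ, 0 ≤ V ω := by
    have := condExp_nonneg (m := F) (μ := ℙ) (f := fun ω' => X ω' ^ 2)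
      (Filter.Eventually.of_forall fun ω => sq_nonneg (X ω))
    filter_upwards [this] with ω h using h
  have hVm : StronglyMeasurable[F] V := stronglyMeasurable_condExp
  have hcX : ∀ᵐ ω ∂ℙ, |c * X ω| ≤ 1 := by
    filter_upwards [hXb] with ω h
    rw [abs_mul, abs_of_pos hc]
    exact (mul_le_mul_of_nonneg_left h hc.le).trans hcb
  have hbd : ∀ᵐ ω ∂ℙ, L ω * Real.exp (c * X ω - c ^ 2 * V ω) ≤ C * Real.exp 1 := by
    filter_upwards [hcX, hV0, hLC] with ω h1 h2 h3
    have h4 : 0 ≤ c ^ 2 * V ω := by positivity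
    have h5 := (abs_le.1 h1).2
    exact mul_le_mul h3 (Real.exp_le_exp.2 (by linarith)) (Real.exp_pos _).le ((hL0 ω).trans h3)
  refine ⟨?_, hbd⟩
  have hX2 : Integrable (fun ω => X ω ^ 2) ℙ := by
    refine Integrable.of_bound (hX.1.pow 2) (b ^ 2) ?_
    filter_upwards [hXb] with ω h
    rw [Real.norm_eq_abs, abs_of_nonneg (sq_nonneg _)]
    exact sq_le_sq' (abs_le.1 h).1 (abs_le.1 h).2
  have hLint : Integrable L ℙ := by
    refine Integrable.of_bound (hL.mono hF).aestronglyMeasurable C ?_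
    filter_upwards [hLC] with ω h
    rwa [Real.norm_eq_abs, abs_of_nonneg (hL0 ω)]
  set A : Ω → ℝ := fun ω => L ω * Real.exp (-(c ^ 2 * V ω)) with hA
  have hAm : StronglyMeasurable[F] A :=
    hL.mul (Real.continuous_exp.comp_stronglyMeasurable (hVm.const_mul (c ^ 2)).neg)
  have hA0 : ∀ ω, 0 ≤ A ω := fun ω => mul_nonneg (hL0 ω) (Real.exp_pos _).le
  have hAC : ∀ᵐ ω ∂ℙ, ‖A ω‖ ≤ C := by
    filter_upwards [hV0, hLC] with ω h2 h3
    have h4 : 0 ≤ c ^ 2 * V ω := by positivity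
    rw [Real.norm_eq_abs, abs_of_nonneg (hA0 ω)]
    have : Real.exp (-(c ^ 2 * V ω)) ≤ 1 := Real.exp_le_one_iff.2 (by linarith)
    exact (mul_le_of_le_one_right (hL0 ω) this).trans h3
  set Y : Ω → ℝ := fun ω => 1 + c * X ω + c ^ 2 * X ω ^ 2 with hY
  have hYi : Integrable Y ℙ :=
    ((integrable_const 1).add (hX.const_mul c)).add (hX2.const_mul (c ^ 2))
  have hYc : ℙ[Y | F] =ᵐ[ℙ] fun ω => 1 + c ^ 2 * V ω := by
    have e1 : ℙ[Y | F] =ᵐ[ℙ] ℙ[(fun _ => (1:ℝ)) + c • X | F] + ℙ[c ^ 2 • fun ω => X ω ^ 2 | F] :=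
      condExp_add ((integrable_const 1).add (hX.const_mul c)) (hX2.const_mul (c ^ 2)) F
    have e2 : ℙ[(fun _ => (1:ℝ)) + c • X | F] =ᵐ[ℙ] ℙ[(fun _ => (1:ℝ)) | F] + ℙ[c • X | F] :=
      condExp_add (integrable_const 1) (hX.const_mul c) F
    have e3 := condExp_smul (μ := ℙ) c X F
    have e4 := condExp_smul (μ := ℙ) (c ^ 2) (fun ω => X ω ^ 2) F
    have e5 := condExp_const (μ := ℙ) hF (1 : ℝ)
    filter_upwards [e1, e2, e3, e4, hX0] with ω h1 h2 h3 h4 h5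
    rw [h1, Pi.add_apply, h2, Pi.add_apply, h3, h4, e5]
    simp [h5, hV]
  have hAY : Integrable (fun ω => A ω * Y ω) ℙ :=
    hYi.bdd_mul (hAm.mono hF).aestronglyMeasurable hAC
  have key : ℙ[fun ω => A ω * Y ω | F] =ᵐ[ℙ] fun ω => A ω * (1 + c ^ 2 * V ω) := by
    have := condExp_mul_of_stronglyMeasurable_left hAm hAY hYi
    filter_upwards [this, hYc] with ω h1 h2
    have h3 : (ℙ[A * Y | F]) ω = A ω * (ℙ[Y | F]) ω := h1
    rw [← h2]; exact h3
  calc ∫ ω, L ω * Real.exp (c * X ω - c ^ 2 * V ω) ∂ℙ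
      ≤ ∫ ω, A ω * Y ω ∂ℙ := by
        refine integral_mono_of_nonneg
          (Filter.Eventually.of_forall fun ω => mul_nonneg (hL0 ω) (Real.exp_pos _).le) hAY ?_
        filter_upwards [hcX] with ω h
        have h1 := (abs_le.1 (Real.abs_exp_sub_one_sub_id_le h)).2
        have h2 : Real.exp (c * X ω - c ^ 2 * V ω)
            = Real.exp (-(c ^ 2 * V ω)) * Real.exp (c * X ω) := by
          rw [← Real.exp_add]; congr 1; ring
        show _ ≤ A ω * Y ω
        simp only [h2, ← mul_assoc]
        exact mul_le_mul_of_nonneg_left (by simp only [hY]; nlinarith) (hA0 ω)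
    _ = ∫ ω, (ℙ[fun ω => A ω * Y ω | F]) ω ∂ℙ := (integral_condExp hF).symm
    _ = ∫ ω, A ω * (1 + c ^ 2 * V ω) ∂ℙ := integral_congr_ae key
    _ ≤ ∫ ω, L ω ∂ℙ := by
        refine integral_mono_of_nonneg ?_ hLint ?_
        · filter_upwards [hV0] with ω h
          exact mul_nonneg (hA0 ω) (by positivity)
        · refine Filter.Eventually.of_forall fun ω => ?_
          have h1 := Real.add_one_le_exp (c ^ 2 * V ω)
          have h2 : Real.exp (-(c ^ 2 * V ω)) * (1 + c ^ 2 * V ω) ≤ 1 := by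
            calc _ ≤ Real.exp (-(c ^ 2 * V ω)) * Real.exp (c ^ 2 * V ω) :=
                  mul_le_mul_of_nonneg_left (by linarith) (Real.exp_pos _).le
              _ = 1 := by rw [← Real.exp_add]; simp
          simp only [hA, mul_assoc]
          exact mul_le_of_le_one_right (hL0 ω) h2

/-- **Bernstein-type inequality for conditionally bounded increments** (Zhang, 2005).
If `|ξ_k - E[ξ_k | 𝔉_{k-1}]| ≤ b` a.s. for `k = 1, …, n` and
`σ_n² = ∑_{k=1}^n E[(ξ_k - E[ξ_k | 𝔉_{k-1}])² | 𝔉_{k-1}]`, then for every `ρ ∈ (0,1]` and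
`δ ∈ (0,1)`, with probability at least `1 - δ`,
`∑ ξ_k - ∑ E[ξ_k | 𝔉_{k-1}] ≤ ρ σ_n² / b + b log(1/δ) / ρ`. -/
theorem stmt7 {Ω : Type*} {m : MeasurableSpace Ω} (ℙ : Measure Ω) [IsProbabilityMeasure ℙ]
    (n : ℕ) (𝔉 : ℕ → MeasurableSpace Ω) (h𝔉mono : Monotone 𝔉) (h𝔉le : ∀ k, 𝔉 k ≤ m)
    (ξ : ℕ → Ω → ℝ)
    (hmeas : ∀ k, 1 ≤ k → k ≤ n → Measurable[𝔉 k] (ξ k))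
    (hint : ∀ k, 1 ≤ k → k ≤ n → Integrable (ξ k) ℙ)
    (b : ℝ) (hb : 0 < b)
    (hbdd : ∀ k, 1 ≤ k → k ≤ n →
      ∀ᵐ ω ∂ℙ, |ξ k ω - (ℙ[ξ k | 𝔉 (k - 1)]) ω| ≤ b)
    (ρ δ : ℝ) (hρ : ρ ∈ Set.Ioc (0 : ℝ) 1) (hδ : δ ∈ Set.Ioo (0 : ℝ) 1) :
    ENNReal.ofReal (1 - δ) ≤
      ℙ {ω | ∑ k ∈ Finset.Icc 1 n, ξ k ω - ∑ k ∈ Finset.Icc 1 n, (ℙ[ξ k | 𝔉 (k - 1)]) ω ≤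
        ρ * (∑ k ∈ Finset.Icc 1 n,
            (ℙ[fun ω' => (ξ k ω' - (ℙ[ξ k | 𝔉 (k - 1)]) ω') ^ 2 | 𝔉 (k - 1)]) ω) / b
          + b * Real.log (1 / δ) / ρ} := by
  obtain ⟨hρ0, hρ1⟩ := hρ
  obtain ⟨hδ0, hδ1⟩ := hδ
  set X : ℕ → Ω → ℝ := fun k ω => ξ k ω - (ℙ[ξ k | 𝔉 (k - 1)]) ω with hXdef
  set V : ℕ → Ω → ℝ := fun k => ℙ[fun ω' => X k ω' ^ 2 | 𝔉 (k - 1)] with hVdef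
  set c : ℝ := ρ / b with hcdef
  have hc : 0 < c := div_pos hρ0 hb
  have hcb : c * b ≤ 1 := by rw [hcdef, div_mul_cancel₀ _ hb.ne']; exact hρ1
  set L : ℕ → Ω → ℝ := fun j ω =>
    Real.exp (∑ k ∈ Finset.Icc 1 j, (c * X k ω - c ^ 2 * V k ω)) with hLdef
  have main : ∀ j, j ≤ n → StronglyMeasurable[𝔉 j] (L j) ∧ (∃ C, ∀ᵐ ω ∂ℙ, L j ω ≤ C) ∧
      ∫ ω, L j ω ∂ℙ ≤ 1 := by
    intro j
    induction j with
    | zero =>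
      intro _
      have : L 0 = fun _ => 1 := by funext ω; simp [hLdef]
      rw [this]
      exact ⟨stronglyMeasurable_const, ⟨1, by simp⟩, by simp⟩
    | succ j ih =>
      intro hj
      obtain ⟨h1, ⟨C, h2⟩, h3⟩ := ih (by omega)
      have hL : L (j + 1) = fun ω =>
          L j ω * Real.exp (c * X (j + 1) ω - c ^ 2 * V (j + 1) ω) := by
        funext ω
        simp only [hLdef]
        rw [Finset.sum_Icc_succ_top (by omega), Real.exp_add]
      have hmj : 𝔉 j ≤ 𝔉 (j + 1) := h𝔉mono (by omega)
      have hi := hint (j + 1) (by omega) hj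
      have hXi : Integrable (X (j + 1)) ℙ := hi.sub integrable_condExp
      have hX0 : ℙ[X (j + 1) | 𝔉 j] =ᵐ[ℙ] 0 := by
        have e1 : ℙ[X (j + 1) | 𝔉 j] =ᵐ[ℙ] ℙ[ξ (j + 1) | 𝔉 j] - ℙ[ℙ[ξ (j + 1) | 𝔉 j] | 𝔉 j] :=
          condExp_sub hi integrable_condExp (𝔉 j)
        rw [condExp_of_stronglyMeasurable (h𝔉le j) stronglyMeasurable_condExp
          integrable_condExp, sub_self] at e1
        exact e1
      obtain ⟨s1, s2⟩ := step_aux ℙ (𝔉 j) (h𝔉le j) (X (j + 1)) (L j) hXi b c C hb hc hcb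
        (hbdd (j + 1) (by omega) hj) hX0 h1 (fun ω => (Real.exp_pos _).le) h2
      rw [hL]
      refine ⟨?_, ⟨_, s2⟩, s1.trans h3⟩
      have m1 : StronglyMeasurable[𝔉 (j + 1)] (ξ (j + 1)) :=
        (hmeas (j + 1) (by omega) hj).stronglyMeasurable
      have m2 : StronglyMeasurable[𝔉 (j + 1)] (X (j + 1)) :=
        m1.sub ((stronglyMeasurable_condExp (m := 𝔉 j)).mono hmj)
      have m3 : StronglyMeasurable[𝔉 (j + 1)] (V (j + 1)) :=
        (stronglyMeasurable_condExp (m := 𝔉 j)).mono hmj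
      exact (h1.mono hmj).mul (Real.continuous_exp.comp_stronglyMeasurable
        ((m2.const_mul c).sub (m3.const_mul (c ^ 2))))
  obtain ⟨h1, ⟨C, h2⟩, h3⟩ := main n le_rfl
  have hLm := h1.mono (h𝔉le n)
  have hLint : Integrable (L n) ℙ := by
    refine Integrable.of_bound hLm.aestronglyMeasurable C ?_
    filter_upwards [h2] with ω h
    rwa [Real.norm_eq_abs, abs_of_nonneg (Real.exp_pos _).le]
  have hmk := mul_meas_ge_le_integral_of_nonneg (μ := ℙ) (f := L n)
    (Filter.Eventually.of_forall fun ω => (Real.exp_pos _).le) hLint (1 / δ)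
  have hS : MeasurableSet {ω | 1 / δ ≤ L n ω} :=
    measurableSet_le measurable_const hLm.measurable
  have hP : ℙ.real {ω | 1 / δ ≤ L n ω} ≤ δ := by
    have := hmk.trans h3
    rw [one_div, inv_mul_le_iff₀ hδ0] at this
    simpa using this
  have hcompl : ENNReal.ofReal (1 - δ) ≤ ℙ {ω | 1 / δ ≤ L n ω}ᶜ := by
    apply ENNReal.ofReal_le_of_le_toReal
    have := probReal_compl_eq_one_sub (μ := ℙ) hS
    change 1 - δ ≤ ℙ.real _
    rw [this]; linarith
  refine hcompl.trans (measure_mono fun ω hω => ?_)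
  simp only [Set.mem_compl_iff, Set.mem_setOf_eq, not_le] at hω ⊢
  have hlog : ∑ k ∈ Finset.Icc 1 n, (c * X k ω - c ^ 2 * V k ω) < Real.log (1 / δ) :=
    (Real.lt_log_iff_exp_lt (by positivity)).2 hω
  rw [Finset.sum_sub_distrib, ← Finset.mul_sum, ← Finset.mul_sum] at hlog
  rw [← Finset.sum_sub_distrib]
  change ∑ k ∈ Finset.Icc 1 n, X k ω ≤ ρ * (∑ k ∈ Finset.Icc 1 n, V k ω) / b + _
  have e1 : ρ * (∑ k ∈ Finset.Icc 1 n, V k ω) / b + b * Real.log (1 / δ) / ρ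
      = (c ^ 2 * (∑ k ∈ Finset.Icc 1 n, V k ω) + Real.log (1 / δ)) / c := by
    rw [hcdef]; field_simp
  rw [e1, le_div_iff₀ hc]
  linarith
end

section
/- Let (Ω, 𝔉, ℙ) be a probability space with a filtration (𝔉_k)_{k≥0}, and let (ξ_k)_{k≥1} be a martingale difference sequence in ℝ^d with respect to (𝔉_k), i.e., ξ_k is 𝔉_k-measurable and E[ξ_k | 𝔉_{k−1}] = 0. Let D > 0 and let t be a positive integer, and suppose that almost surely ‖ξ_k‖ ≤ D for all k ≤ t and Σ_{k=1}^t E[‖ξ_k‖² | 𝔉_{k−1}] ≤ σ_t² for a real number σ_t ≥ 0. Then for every δ ∈ (0,1), with probability at least 1 − δ, max_{1 ≤ j ≤ t} ‖Σ_{k=1}^j ξ_k‖ ≤ 2·(D/3 + σ_t)·log(2/δ), where ‖·‖ is the Euclidean norm. -/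
open MeasureTheory

lemma aux_phi {x y : ℝ} (hx : 0 ≤ x) (hxy : x ≤ y) (hy : y < 3) :
    Real.exp x ≤ 1 + x + 3 * x ^ 2 / (6 - 2 * y) := by
  have key : ∀ x : ℝ, 0 ≤ x → 0 ≤ x ^ 2 + 4 * x + 6 + (2 * x - 6) * Real.exp x := by
    have h1 : ∀ x : ℝ, 0 ≤ x → 0 ≤ 2 * x + 4 + (2 * x - 4) * Real.exp x := by
      have hd : ∀ x : ℝ, HasDerivAt (fun x : ℝ => 2 * x + 4 + (2 * x - 4) * Real.exp x)
          (2 + (2 * x - 2) * Real.exp x) x := by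
        intro x
        have := (((hasDerivAt_id x).const_mul 2).add_const 4).add
          ((((hasDerivAt_id x).const_mul 2).sub_const 4).mul (Real.hasDerivAt_exp x))
        refine this.congr_deriv ?_
        simp; ring
      have hm : Monotone (fun x : ℝ => 2 * x + 4 + (2 * x - 4) * Real.exp x) := by
        apply monotone_of_deriv_nonneg (fun x => (hd x).differentiableAt)
        intro x
        rw [(hd x).deriv]
        have h := Real.add_one_le_exp (-x)
        have h2 : Real.exp (-x) * Real.exp x = 1 := by rw [← Real.exp_add]; simp
        nlinarith [Real.exp_pos x]
      intro x hx
      have := hm hx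
      simp at this
      linarith
    have hd : ∀ x : ℝ, HasDerivAt (fun x : ℝ => x ^ 2 + 4 * x + 6 + (2 * x - 6) * Real.exp x)
        (2 * x + 4 + (2 * x - 4) * Real.exp x) x := by
      intro x
      have := ((((hasDerivAt_id x).pow 2).add ((hasDerivAt_id x).const_mul 4)).add_const 6).add
        ((((hasDerivAt_id x).const_mul 2).sub_const 6).mul (Real.hasDerivAt_exp x))
      refine this.congr_deriv ?_
      simp; ring
    have hm : MonotoneOn (fun x : ℝ => x ^ 2 + 4 * x + 6 + (2 * x - 6) * Real.exp x)
        (Set.Ici 0) := by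
      apply monotoneOn_of_deriv_nonneg (convex_Ici 0)
        (fun x _ => (hd x).continuousAt.continuousWithinAt)
        (fun x _ => (hd x).differentiableAt.differentiableWithinAt)
      intro x hx
      rw [(hd x).deriv]
      simp at hx
      exact h1 x hx.le
    intro x hx
    have := hm (Set.mem_Ici.2 le_rfl) (Set.mem_Ici.2 hx) hx
    simp at this
    linarith
  have h := key x hx
  have h1 : Real.exp x ≤ 1 + x + 3 * x ^ 2 / (6 - 2 * x) := by
    rw [← sub_le_iff_le_add', le_div_iff₀ (by linarith)]
    nlinarith
  have h2 : 3 * x ^ 2 / (6 - 2 * x) ≤ 3 * x ^ 2 / (6 - 2 * y) := by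
    apply div_le_div_of_nonneg_left (by positivity) (by linarith) (by linarith)
  linarith

lemma aux_cosh {E : Type*} [NormedAddCommGroup E] [InnerProductSpace ℝ E] (x y : E) :
    Real.cosh ‖x + y‖ ≤ Real.cosh ‖x‖ * (Real.exp ‖y‖ - ‖y‖)
      + inner ℝ ((Real.sinh ‖x‖ / ‖x‖) • x) y := by
  set a := ‖x‖ with ha
  set b := ‖y‖ with hb
  have ha0 : 0 ≤ a := norm_nonneg _
  have hb0 : 0 ≤ b := norm_nonneg _
  obtain ⟨c, hc1, hc2, hc⟩ : ∃ c : ℝ, -1 ≤ c ∧ c ≤ 1 ∧ inner ℝ x y = c * a * b := by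
    refine ⟨inner ℝ x y / (a * b), ?_, ?_, ?_⟩
    · exact (abs_le.1 (abs_real_inner_div_norm_mul_norm_le_one x y)).1
    · exact (abs_le.1 (abs_real_inner_div_norm_mul_norm_le_one x y)).2
    · rcases eq_or_ne (a * b) 0 with h | h
      · have := abs_real_inner_le_norm x y
        rw [← ha, ← hb, h] at this
        have h3 := abs_nonpos_iff.1 this
        rw [h3]; simp
      · rw [mul_assoc, div_mul_cancel₀ _ h]
  have hn : ‖x + y‖ ^ 2 = (1 + c) / 2 * (a + b) ^ 2 + (1 - c) / 2 * (a - b) ^ 2 := by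
    rw [norm_add_sq_real, hc]; ring
  have h1 : Real.cosh ‖x + y‖ ≤ (1 + c) / 2 * Real.cosh (a + b) + (1 - c) / 2 * Real.cosh (a - b) := by
    refine hasSum_le (fun n => ?_) (Real.hasSum_cosh ‖x + y‖)
      (((Real.hasSum_cosh (a + b)).mul_left ((1 + c) / 2)).add
        ((Real.hasSum_cosh (a - b)).mul_left ((1 - c) / 2)))
    rw [pow_mul, pow_mul, pow_mul, hn, ← mul_div_assoc, ← mul_div_assoc, ← add_div]
    apply div_le_div_of_nonneg_right _ (by positivity)
    have := ((convexOn_pow (𝕜 := ℝ) n)).2 (Set.mem_Ici.2 (sq_nonneg (a + b)))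
      (Set.mem_Ici.2 (sq_nonneg (a - b))) (show 0 ≤ (1 + c) / 2 by linarith)
      (show 0 ≤ (1 - c) / 2 by linarith) (by ring)
    simpa using this
  have h2 : inner ℝ ((Real.sinh a / a) • x) y = c * Real.sinh a * b := by
    rw [real_inner_smul_left, hc]
    rcases eq_or_ne a 0 with h | h
    · simp [h]
    · field_simp
  rw [h2]
  rw [Real.cosh_add, Real.cosh_sub] at h1
  have h3 : b ≤ Real.sinh b := Real.self_le_sinh_iff.2 hb0
  have h4 : Real.exp b = Real.cosh b + Real.sinh b := (Real.cosh_add_sinh b).symm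
  have h5 : Real.sinh a ≤ Real.cosh a := (Real.sinh_lt_cosh a).le
  have h6 : 0 ≤ Real.sinh a := Real.sinh_nonneg_iff.2 ha0
  have h7 : c * Real.sinh a ≤ Real.cosh a := by nlinarith
  rw [h4]
  nlinarith [mul_le_mul_of_nonneg_right h7 (sub_nonneg.2 h3)]

lemma aux_lam {D σ L : ℝ} (hD : 0 < D) (hσ : 0 ≤ σ) (hL : Real.log 2 ≤ L) :
    ∃ l : ℝ, 0 < l ∧ l * D < 3 ∧
      L ≤ l * (2 * (D / 3 + σ) * L) - 3 * l ^ 2 / (6 - 2 * (l * D)) * σ ^ 2 := by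
  have hs : 0 < D / 3 + σ := by positivity
  have h2 := Real.log_two_gt_d9
  refine ⟨3 / (4 * (D / 3 + σ)), by positivity, ?_, ?_⟩
  · rw [div_mul_eq_mul_div, div_lt_iff₀ (by positivity)]; nlinarith
  · have e1 : 3 / (4 * (D / 3 + σ)) * (2 * (D / 3 + σ) * L) = 3 / 2 * L := by
      field_simp
      ring
    have hp : 0 < D + 12 * σ := by positivity
    have e2 : 3 * (3 / (4 * (D / 3 + σ))) ^ 2 / (6 - 2 * (3 / (4 * (D / 3 + σ)) * D)) * σ ^ 2
        ≤ 9 / 32 := by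
      have e3 : 6 - 2 * (3 / (4 * (D / 3 + σ)) * D) = (D / 2 + 6 * σ) / (D / 3 + σ) := by
        field_simp
        ring
      rw [e3]
      have : 3 * (3 / (4 * (D / 3 + σ))) ^ 2 / ((D / 2 + 6 * σ) / (D / 3 + σ)) * σ ^ 2
        = 27 * σ ^ 2 / (16 * (D / 3 + σ) * (D / 2 + 6 * σ)) := by
        field_simp
        try ring
      rw [this, div_le_iff₀ (by positivity)]
      nlinarith [mul_nonneg hD.le hσ, sq_nonneg D]
    rw [e1]
    linarith

lemma div_mul_le_of_le_mul_aux (a b : ℝ) (ha : 0 ≤ a) : a / b * b ≤ a := by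
  rcases eq_or_ne b 0 with h | h
  · simpa [h] using ha
  · rw [div_mul_cancel₀ _ h]

lemma aux_step {Ω : Type*} {m : MeasurableSpace Ω} (ℙ : Measure Ω) [IsProbabilityMeasure ℙ]
    (d : ℕ) (G : MeasurableSpace Ω) (hG : G ≤ m) (S ξ : Ω → EuclideanSpace ℝ (Fin d))
    (hS : Measurable[G] S) (hξ : Integrable ξ ℙ) (hmds : ℙ[ξ | G] =ᵐ[ℙ] 0)
    (Z : Ω → ℝ) (hZ : Measurable[G] Z) (hZ0 : ∀ ω, 0 ≤ Z ω) (hZ1 : ∀ᵐ ω ∂ℙ, Z ω ≤ 1)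
    (M D l : ℝ) (hl : 0 < l) (hlD : l * D < 3) (hSM : ∀ᵐ ω ∂ℙ, ‖S ω‖ ≤ M)
    (hD : ∀ᵐ ω ∂ℙ, ‖ξ ω‖ ≤ D) :
    ∫ ω, Z ω * Real.cosh (l * ‖S ω + ξ ω‖) ∂ℙ ≤
      ∫ ω, Z ω * Real.exp (3 * l ^ 2 / (6 - 2 * (l * D)) * (ℙ[fun ω' => ‖ξ ω'‖ ^ 2 | G]) ω)
        * Real.cosh (l * ‖S ω‖) ∂ℙ := by
  set K := 3 * l ^ 2 / (6 - 2 * (l * D)) with hK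
  have hK0 : 0 ≤ K := div_nonneg (by positivity) (by linarith)
  set v := ℙ[fun ω' => ‖ξ ω'‖ ^ 2 | G] with hv
  have hξm : AEStronglyMeasurable[m] ξ ℙ := hξ.1
  have hD0 : ∀ᵐ ω ∂ℙ, ‖ξ ω‖ ^ 2 ≤ D ^ 2 := by
    filter_upwards [hD] with ω h using by gcongr
  have hξ2 : Integrable (fun ω' => ‖ξ ω'‖ ^ 2) ℙ := by
    refine Integrable.of_bound (hξm.norm.pow 2) (D ^ 2) ?_
    filter_upwards [hD0] with ω h
    rw [Real.norm_of_nonneg (by positivity)]; exact h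
  have hv0 : ∀ᵐ ω ∂ℙ, 0 ≤ v ω := condExp_nonneg (ae_of_all _ fun ω => by positivity)
  have hvD : ∀ᵐ ω ∂ℙ, v ω ≤ D ^ 2 := by
    have := condExp_mono (m := G) hξ2 (integrable_const (D ^ 2)) hD0
    rw [condExp_const hG] at this
    exact this
  have hvm : Measurable[G] v := stronglyMeasurable_condExp.measurable
  -- the weight
  set W : Ω → ℝ := fun ω => Z ω * Real.cosh (l * ‖S ω‖) with hW
  have hWm : Measurable[G] W :=
    hZ.mul (Real.measurable_cosh.comp (measurable_const.mul hS.norm))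
  have hW0 : ∀ ω, 0 ≤ W ω := fun ω => mul_nonneg (hZ0 ω) (Real.cosh_pos _).le
  have hcosh : ∀ {x y : ℝ}, 0 ≤ x → x ≤ y → Real.cosh x ≤ Real.cosh y := fun hx hxy => by
    rw [Real.cosh_le_cosh, abs_of_nonneg hx, abs_of_nonneg (hx.trans hxy)]; exact hxy
  have hWb : ∀ᵐ ω ∂ℙ, W ω ≤ Real.cosh (l * M) := by
    filter_upwards [hZ1, hSM] with ω h1 h2
    calc W ω ≤ 1 * Real.cosh (l * ‖S ω‖) := by
          apply mul_le_mul_of_nonneg_right h1 (Real.cosh_pos _).le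
      _ ≤ _ := by rw [one_mul]; exact hcosh (by positivity) (by gcongr)
  have hWi : Integrable W ℙ := by
    refine Integrable.of_bound (hWm.mono hG le_rfl).aestronglyMeasurable (Real.cosh (l * M)) ?_
    filter_upwards [hWb] with ω h
    rw [Real.norm_of_nonneg (hW0 ω)]; exact h
  set U : Ω → EuclideanSpace ℝ (Fin d) := fun ω =>
    Z ω • (l • ((Real.sinh ‖l • S ω‖ / ‖l • S ω‖) • (l • S ω))) with hU
  have hUm : Measurable[G] U := by
    have h1 : Measurable[G] fun ω => l • S ω := hS.const_smul l
    have h2 : Measurable[G] fun ω => Real.sinh ‖l • S ω‖ / ‖l • S ω‖ :=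
      (Real.measurable_sinh.comp h1.norm).div h1.norm
    exact hZ.smul ((h2.smul h1).const_smul l)
  have hUb : ∀ᵐ ω ∂ℙ, ‖U ω‖ ≤ l * Real.cosh (l * M) := by
    filter_upwards [hWb] with ω h1
    have h2 : ‖(Real.sinh ‖l • S ω‖ / ‖l • S ω‖) • (l • S ω)‖ ≤ Real.cosh (l * ‖S ω‖) := by
      have e : ‖l • S ω‖ = l * ‖S ω‖ := by rw [norm_smul, Real.norm_of_nonneg hl.le]
      rw [norm_smul, norm_div, norm_norm, Real.norm_of_nonneg (Real.sinh_nonneg_iff.2 (norm_nonneg _))]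
      refine le_trans ?_ (Real.sinh_lt_cosh _).le
      rw [e]
      exact div_mul_le_of_le_mul_aux _ _ (Real.sinh_nonneg_iff.2 (by positivity))
    rw [hU]
    simp only
    rw [norm_smul, norm_smul, Real.norm_of_nonneg hl.le, Real.norm_of_nonneg (hZ0 ω)]
    have h3 := mul_le_mul_of_nonneg_left h2 (hZ0 ω)
    have h4 := mul_le_mul_of_nonneg_left (h3.trans h1) hl.le
    linarith
  have hUint : Integrable (fun ω => inner ℝ (U ω) (ξ ω)) ℙ := by
    refine Integrable.of_bound ((hUm.mono hG le_rfl).aestronglyMeasurable.inner hξm)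
      (l * Real.cosh (l * M) * D) ?_
    filter_upwards [hUb, hD] with ω h1 h2
    refine (norm_inner_le_norm _ _).trans ?_
    gcongr
  have hUz : ∫ ω, inner ℝ (U ω) (ξ ω) ∂ℙ = 0 := by
    rw [← integral_condExp hG]
    have := condExp_bilin_of_stronglyMeasurable_left (innerSL ℝ) (m := G) hUm.stronglyMeasurable
      hUint hξ
    rw [integral_congr_ae (g := fun _ => (0 : ℝ)), integral_zero]
    filter_upwards [this, hmds] with ω h1 h2
    refine h1.trans ?_
    rw [h2]; simp
  have hWξ : Integrable (fun ω => W ω * ‖ξ ω‖ ^ 2) ℙ := by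
    refine hξ2.bdd_mul (c := Real.cosh (l * M)) (hWm.mono hG le_rfl).aestronglyMeasurable ?_
    filter_upwards [hWb] with ω h
    rw [Real.norm_of_nonneg (hW0 ω)]; exact h
  have hWv : Integrable (fun ω => W ω * v ω) ℙ := by
    refine (integrable_condExp).bdd_mul (c := Real.cosh (l * M)) (hWm.mono hG le_rfl).aestronglyMeasurable ?_
    filter_upwards [hWb] with ω h
    rw [Real.norm_of_nonneg (hW0 ω)]; exact h
  have hWe : ∫ ω, W ω * ‖ξ ω‖ ^ 2 ∂ℙ = ∫ ω, W ω * v ω ∂ℙ := by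
    rw [← integral_condExp hG]
    exact integral_congr_ae (condExp_mul_of_stronglyMeasurable_left hWm.stronglyMeasurable hWξ hξ2)
  have hpt : ∀ᵐ ω ∂ℙ, Z ω * Real.cosh (l * ‖S ω + ξ ω‖) ≤
      (W ω + K * (W ω * ‖ξ ω‖ ^ 2)) + inner ℝ (U ω) (ξ ω) := by
    filter_upwards [hD] with ω h
    have h1 := aux_cosh (l • S ω) (l • ξ ω)
    have h2 := aux_phi (x := l * ‖ξ ω‖) (y := l * D) (by positivity) (by gcongr) hlD
    have e1 : ∀ x : EuclideanSpace ℝ (Fin d), ‖l • x‖ = l * ‖x‖ := fun x => by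
      rw [norm_smul, Real.norm_of_nonneg hl.le]
    have e2 : inner ℝ (U ω) (ξ ω) = Z ω * inner ℝ ((Real.sinh ‖l • S ω‖ / ‖l • S ω‖) • (l • S ω)) (l • ξ ω) := by
      simp only [hU]
      rw [real_inner_smul_left, real_inner_smul_left _ _ l, real_inner_smul_right]
    rw [e2]
    rw [← smul_add, e1 (S ω + ξ ω), e1 (ξ ω)] at h1
    have h3 : Real.exp (l * ‖ξ ω‖) - l * ‖ξ ω‖ ≤ 1 + K * ‖ξ ω‖ ^ 2 := by
      have : 3 * (l * ‖ξ ω‖) ^ 2 / (6 - 2 * (l * D)) = K * ‖ξ ω‖ ^ 2 := by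
        rw [hK]; ring
      linarith
    have h4 := mul_le_mul_of_nonneg_left h1 (hZ0 ω)
    have h5 := mul_le_mul_of_nonneg_left h3 (hW0 ω)
    have h6 : Real.cosh ‖l • S ω‖ = Real.cosh (l * ‖S ω‖) := by rw [e1]
    rw [h6] at h4
    simp only [hW] at h5 ⊢
    nlinarith
  have hRi : Integrable (fun ω => Z ω * Real.exp (K * v ω) * Real.cosh (l * ‖S ω‖)) ℙ := by
    refine Integrable.of_bound (C := Real.cosh (l * M) * Real.exp (K * D ^ 2)) ?_ ?_
    · refine Measurable.aestronglyMeasurable (Measurable.mono ?_ hG le_rfl)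
      exact (hZ.mul (Real.measurable_exp.comp (hvm.const_mul K))).mul
        (Real.measurable_cosh.comp (measurable_const.mul hS.norm))
    · filter_upwards [hWb, hvD] with ω h1 h2
      have e : Z ω * Real.exp (K * v ω) * Real.cosh (l * ‖S ω‖) = W ω * Real.exp (K * v ω) := by
        simp only [hW]; ring
      rw [e, Real.norm_of_nonneg (mul_nonneg (hW0 ω) (Real.exp_pos _).le)]
      gcongr
  have hI2 : Integrable (fun ω => W ω + K * (W ω * ‖ξ ω‖ ^ 2)) ℙ := hWi.add (hWξ.const_mul K)
  calc ∫ ω, Z ω * Real.cosh (l * ‖S ω + ξ ω‖) ∂ℙ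
      ≤ ∫ ω, ((W ω + K * (W ω * ‖ξ ω‖ ^ 2)) + inner ℝ (U ω) (ξ ω)) ∂ℙ := by
        refine integral_mono_of_nonneg (ae_of_all _ fun ω => ?_) (hI2.add hUint) hpt
        exact mul_nonneg (hZ0 ω) (Real.cosh_pos _).le
    _ = ∫ ω, W ω ∂ℙ + K * ∫ ω, W ω * v ω ∂ℙ := by
        rw [integral_add hI2 hUint, hUz, add_zero, integral_add hWi (hWξ.const_mul K),
          integral_const_mul, hWe]
    _ = ∫ ω, (W ω + K * (W ω * v ω)) ∂ℙ := by
        rw [integral_add hWi (hWv.const_mul K), integral_const_mul]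
    _ ≤ _ := by
        refine integral_mono (hWi.add (hWv.const_mul K)) hRi fun ω => ?_
        have := Real.add_one_le_exp (K * v ω)
        have := mul_le_mul_of_nonneg_left this (hW0 ω)
        simp only [hW] at this ⊢
        nlinarith
/-- **Pinelis–Bernstein inequality for vector-valued martingale difference sequences.**
If `(ξ_k)` is a martingale difference sequence in `ℝ^d` with `‖ξ_k‖ ≤ D` a.s. and total
conditional variance `∑_{k=1}^t E[‖ξ_k‖² | 𝔉_{k-1}] ≤ σ_t²` a.s., then for every `δ ∈ (0,1)`,
with probability at least `1 - δ`,
`max_{1 ≤ j ≤ t} ‖∑_{k=1}^j ξ_k‖ ≤ 2 (D/3 + σ_t) log(2/δ)`. -/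
theorem stmt8 {Ω : Type*} {m : MeasurableSpace Ω} (ℙ : Measure Ω) [IsProbabilityMeasure ℙ]
    (d : ℕ) (𝔉 : ℕ → MeasurableSpace Ω) (h𝔉mono : Monotone 𝔉) (h𝔉le : ∀ k, 𝔉 k ≤ m)
    (ξ : ℕ → Ω → EuclideanSpace ℝ (Fin d))
    (hmeas : ∀ k, 1 ≤ k → Measurable[𝔉 k] (ξ k))
    (hint : ∀ k, 1 ≤ k → Integrable (ξ k) ℙ)
    (hmds : ∀ k, 1 ≤ k → ℙ[ξ k | 𝔉 (k - 1)] =ᵐ[ℙ] 0)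
    (D : ℝ) (hD : 0 < D) (t : ℕ) (ht : 0 < t) (σt : ℝ) (hσt : 0 ≤ σt)
    (hbdd : ∀ᵐ ω ∂ℙ, ∀ k, 1 ≤ k → k ≤ t → ‖ξ k ω‖ ≤ D)
    (hvar : ∀ᵐ ω ∂ℙ,
      ∑ k ∈ Finset.Icc 1 t, (ℙ[fun ω' => ‖ξ k ω'‖ ^ 2 | 𝔉 (k - 1)]) ω ≤ σt ^ 2)
    (δ : ℝ) (hδ : δ ∈ Set.Ioo (0 : ℝ) 1) :
    ENNReal.ofReal (1 - δ) ≤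
      ℙ {ω | ∀ j ∈ Finset.Icc 1 t,
        ‖∑ k ∈ Finset.Icc 1 j, ξ k ω‖ ≤ 2 * (D / 3 + σt) * Real.log (2 / δ)} := by
  classical
  have hL : Real.log 2 ≤ Real.log (2 / δ) := by
    apply Real.log_le_log (by norm_num)
    rw [le_div_iff₀ hδ.1]; nlinarith [hδ.2]
  obtain ⟨l, hl, hlD, hlL⟩ := aux_lam hD hσt hL
  set r := 2 * (D / 3 + σt) * Real.log (2 / δ) with hr
  have hr0 : 0 ≤ r := by
    have : 0 < Real.log 2 := Real.log_pos (by norm_num)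
    have : 0 ≤ Real.log (2 / δ) := by linarith
    positivity
  set K := 3 * l ^ 2 / (6 - 2 * (l * D)) with hK
  have hK0 : 0 ≤ K := div_nonneg (by positivity) (by linarith)
  set v : ℕ → Ω → ℝ := fun k => ℙ[fun ω' => ‖ξ k ω'‖ ^ 2 | 𝔉 (k - 1)] with hv
  set S : ℕ → Ω → EuclideanSpace ℝ (Fin d) := fun n ω => ∑ k ∈ Finset.Icc 1 n, ξ k ω with hS
  set V : ℕ → Ω → ℝ := fun n ω => ∑ k ∈ Finset.Icc 1 n, v k ω with hV
  set A : ℕ → Set Ω := fun n => {ω | ∀ j ∈ Finset.Icc 1 n, ‖S j ω‖ ≤ r} with hA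
  set c := Real.cosh (l * r) * Real.exp (-(K * σt ^ 2)) with hc
  have hc0 : 0 < c := mul_pos (Real.cosh_pos _) (Real.exp_pos _)
  have hSsucc : ∀ n ω, S (n + 1) ω = S n ω + ξ (n + 1) ω := fun n ω =>
    Finset.sum_Icc_succ_top (by omega) _
  have hVsucc : ∀ n ω, V (n + 1) ω = V n ω + v (n + 1) ω := fun n ω =>
    Finset.sum_Icc_succ_top (by omega) _
  have hSm : ∀ n, Measurable[𝔉 n] (S n) := fun n =>
    Finset.measurable_fun_sum _ fun k hk => by
      rw [Finset.mem_Icc] at hk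
      exact (hmeas k hk.1).mono (h𝔉mono hk.2) le_rfl
  have hvm : ∀ k, Measurable[𝔉 (k - 1)] (v k) := fun k => stronglyMeasurable_condExp.measurable
  have hVm : ∀ n, Measurable[𝔉 (n - 1)] (V n) := fun n =>
    Finset.measurable_fun_sum _ fun k hk => by
      rw [Finset.mem_Icc] at hk
      exact (hvm k).mono (h𝔉mono (by omega)) le_rfl
  have hAm : ∀ n, MeasurableSet[𝔉 n] (A n) := by
    intro n
    have : A n = ⋂ j ∈ Finset.Icc 1 n, {ω | ‖S j ω‖ ≤ r} := by
      ext ω; simp [hA]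
    rw [this]
    refine Finset.measurableSet_biInter _ fun j hj => ?_
    rw [Finset.mem_Icc] at hj
    have h1 : Measurable[𝔉 j] fun ω => ‖S j ω‖ := measurable_norm.comp (hSm j)
    exact h𝔉mono hj.2 _ (h1 measurableSet_Iic)
  have hAsucc : ∀ n ω, ω ∈ A (n + 1) ↔ ω ∈ A n ∧ ‖S (n + 1) ω‖ ≤ r := by
    intro n ω
    simp only [hA, Set.mem_ofPred_eq, Finset.mem_Icc]
    constructor
    · intro h
      exact ⟨fun j hj => h j ⟨hj.1, by omega⟩, h (n + 1) ⟨by omega, le_rfl⟩⟩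
    · rintro ⟨h1, h2⟩ j hj
      rcases Nat.lt_or_ge n j with h | h
      · have : j = n + 1 := by omega
        rw [this]; exact h2
      · exact h1 j ⟨hj.1, h⟩
  have hv0 : ∀ᵐ ω ∂ℙ, ∀ k, 0 ≤ v k ω :=
    ae_all_iff.2 fun k => condExp_nonneg (ae_of_all _ fun ω => by positivity)
  have hV0 : ∀ᵐ ω ∂ℙ, ∀ n, 0 ≤ V n ω := by
    filter_upwards [hv0] with ω h n using Finset.sum_nonneg fun k _ => h k
  have hVσ : ∀ᵐ ω ∂ℙ, ∀ n ≤ t, V n ω ≤ σt ^ 2 := by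
    filter_upwards [hv0, hvar] with ω h h2 n hn
    refine le_trans ?_ h2
    exact Finset.sum_le_sum_of_subset_of_nonneg (Finset.Icc_subset_Icc_right hn)
      fun k _ _ => h k
  have hSb : ∀ᵐ ω ∂ℙ, ∀ n ≤ t, ‖S n ω‖ ≤ n * D := by
    filter_upwards [hbdd] with ω h n hn
    refine (norm_sum_le_of_le _ (f := fun k => ξ k ω) (n := fun _ => D) fun k hk => ?_).trans ?_
    · rw [Finset.mem_Icc] at hk
      exact h k hk.1 (hk.2.trans hn)
    · simp
  have hcosh : ∀ {x y : ℝ}, 0 ≤ x → x ≤ y → Real.cosh x ≤ Real.cosh y := fun hx hxy => by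
    rw [Real.cosh_le_cosh, abs_of_nonneg hx, abs_of_nonneg (hx.trans hxy)]; exact hxy
  set Z : ℕ → ℕ → Ω → ℝ := fun n k => (A n).indicator (fun ω => Real.exp (-(K * V k ω))) with hZ
  have hZ0 : ∀ n k ω, 0 ≤ Z n k ω := fun n k ω =>
    Set.indicator_nonneg (fun _ _ => (Real.exp_pos _).le) _
  have hZ1 : ∀ᵐ ω ∂ℙ, ∀ n k, Z n k ω ≤ 1 := by
    filter_upwards [hV0] with ω h n k
    by_cases hω : ω ∈ A n
    · simp only [hZ, Set.indicator_of_mem hω]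
      rw [Real.exp_le_one_iff, neg_nonpos]
      exact mul_nonneg hK0 (h k)
    · simp only [hZ, Set.indicator_of_notMem hω, zero_le_one]
  have hZm : ∀ n k, k ≤ n + 1 → Measurable[𝔉 n] (Z n k) := fun n k hk =>
    Measurable.indicator (Real.measurable_exp.comp
      (((hVm k).mono (h𝔉mono (by omega)) le_rfl).const_mul K).neg) (hAm n)
  have hint2 : ∀ n k, k ≤ n + 1 → ∀ j ≤ t,
      Integrable (fun ω => Z n k ω * Real.cosh (l * ‖S j ω‖)) ℙ := by
    intro n k hk j hj
    refine Integrable.of_bound (C := 1 * Real.cosh (l * (j * D))) ?_ ?_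
    · refine Measurable.aestronglyMeasurable ?_
      exact ((hZm n k hk).mono (h𝔉le n) le_rfl).mul
        (Real.measurable_cosh.comp (measurable_const.mul ((hSm j).mono (h𝔉le j) le_rfl).norm))
    · filter_upwards [hZ1, hSb] with ω h1 h2
      rw [Real.norm_of_nonneg (mul_nonneg (hZ0 n k ω) (Real.cosh_pos _).le)]
      apply mul_le_mul (h1 n k) (hcosh (by positivity) _) (Real.cosh_pos _).le zero_le_one
      have := h2 j hj
      gcongr
  have hIc : ∀ n, Integrable ((A n)ᶜ.indicator fun _ => c) ℙ := fun n =>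
    (integrable_const c).indicator (h𝔉le n _ (hAm n)).compl
  have claim : ∀ n ≤ t, ∫ ω, (Z n n ω * Real.cosh (l * ‖S n ω‖)
      + (A n)ᶜ.indicator (fun _ => c) ω) ∂ℙ ≤ 1 := by
    intro n
    induction n with
    | zero =>
      intro _
      have : A 0 = Set.univ := by ext ω; simp [hA]; intros; omega
      simp [hZ, this, hV, hS]
    | succ n ih =>
      intro hn
      have ih := ih (by omega)
      have step := aux_step ℙ d (𝔉 n) (h𝔉le n) (S n) (ξ (n + 1)) (hSm n) (hint _ (by omega))
        (hmds (n + 1) (by omega)) (Z n (n + 1)) (hZm n (n + 1) le_rfl) (hZ0 n (n + 1))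
        (by filter_upwards [hZ1] with ω h using h _ _) (n * D) D l hl hlD
        (by filter_upwards [hSb] with ω h using h n (by omega))
        (by filter_upwards [hbdd] with ω h using h _ (by omega) hn)
      have e1 : ∀ ω, Z n (n + 1) ω * Real.exp (K * v (n + 1) ω) = Z n n ω := by
        intro ω
        by_cases hω : ω ∈ A n
        · simp only [hZ, Set.indicator_of_mem hω]
          rw [← Real.exp_add, hVsucc]
          congr 1; ring
        · simp only [hZ, Set.indicator_of_notMem hω, zero_mul]
      have step2 : ∫ ω, Z n (n + 1) ω * Real.cosh (l * ‖S (n + 1) ω‖) ∂ℙ ≤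
          ∫ ω, Z n n ω * Real.cosh (l * ‖S n ω‖) ∂ℙ := by
        simp only [hSsucc]
        refine step.trans (le_of_eq ?_)
        congr 1
        ext ω
        rw [← e1 ω]
        rfl
      rw [integral_add (hint2 n n (by omega) n (by omega)) (hIc n)] at ih
      calc _ ≤ ∫ ω, (Z n (n + 1) ω * Real.cosh (l * ‖S (n + 1) ω‖)
              + (A n)ᶜ.indicator (fun _ => c) ω) ∂ℙ := by
            refine integral_mono_ae ((hint2 _ _ (by omega) _ hn).add (hIc _))
              ((hint2 _ _ (by omega) _ hn).add (hIc _)) ?_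
            filter_upwards [hVσ] with ω h
            have h := h (n + 1) hn
            by_cases h1 : ω ∈ A n
            · by_cases h2 : ‖S (n + 1) ω‖ ≤ r
              · have h3 : ω ∈ A (n + 1) := (hAsucc n ω).2 ⟨h1, h2⟩
                simp [hZ, h1, h3]
              · have h3 : ω ∉ A (n + 1) := fun h => h2 ((hAsucc n ω).1 h).2
                push Not at h2
                simp only [hZ, Set.indicator_of_notMem h3, Set.indicator_of_mem h1,
                  Set.indicator_of_mem (Set.mem_compl h3),
                  Set.indicator_of_notMem (Set.notMem_compl_iff.2 h1)]
                rw [zero_mul, zero_add, add_zero, hc, mul_comm]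
                apply mul_le_mul _ (hcosh (by positivity) (by gcongr)) (Real.cosh_pos _).le
                  (Real.exp_pos _).le
                gcongr
            · have h3 : ω ∉ A (n + 1) := fun h => h1 ((hAsucc n ω).1 h).1
              simp [hZ, h1, h3]
        _ = _ := integral_add (hint2 n (n + 1) le_rfl (n + 1) hn) (hIc n)
        _ ≤ _ := by gcongr
        _ ≤ 1 := ih
  have hfin := claim t le_rfl
  rw [integral_add (hint2 t t (by omega) t le_rfl) (hIc t),
    integral_indicator_const _ (h𝔉le t _ (hAm t)).compl, smul_eq_mul] at hfin
  have hnn : 0 ≤ ∫ ω, Z t t ω * Real.cosh (l * ‖S t ω‖) ∂ℙ :=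
    integral_nonneg fun ω => mul_nonneg (hZ0 _ _ _) (Real.cosh_pos _).le
  have hcδ : 1 ≤ δ * c := by
    have h1 : Real.exp (l * r) / 2 ≤ Real.cosh (l * r) := by
      rw [Real.cosh_eq]; have := Real.exp_pos (-(l * r)); linarith
    have h2 : 2 / δ ≤ Real.exp (l * r) * Real.exp (-(K * σt ^ 2)) := by
      rw [← Real.exp_add, ← Real.log_le_iff_le_exp (div_pos two_pos hδ.1)]
      linarith
    have h3 : 2 / δ / 2 ≤ c := by
      rw [hc]
      have := mul_le_mul_of_nonneg_right h1 (Real.exp_pos (-(K * σt ^ 2))).le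
      linarith
    have h4 := mul_le_mul_of_nonneg_left h3 hδ.1.le
    have : δ * (2 / δ / 2) = 1 := by have := hδ.1; field_simp
    linarith
  have hP : ℙ.real (A t)ᶜ ≤ δ := by
    have : ℙ.real (A t)ᶜ * c ≤ δ * c := by linarith
    exact le_of_mul_le_mul_right this hc0
  rw [probReal_compl_eq_one_sub (h𝔉le t _ (hAm t))] at hP
  change ENNReal.ofReal (1 - δ) ≤ ℙ (A t)
  rw [← ofReal_measureReal (measure_ne_top _ _)]
  apply ENNReal.ofReal_le_ofReal
  linarith
end

section
/- Let a_1,…,a_n be positive real numbers and write S_i = Σ_{k=1}^i a_k. Then √(S_n) ≤ Σ_{i=1}^n a_i/√(S_i) ≤ 2·√(S_n). -/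
/-- **Self-normalized sum inequality.** For positive reals `a 1, …, a n` with prefix sums
`S i = ∑_{k=1}^i a k`, we have `√(S n) ≤ ∑_{i=1}^n a i / √(S i) ≤ 2 √(S n)`. -/
theorem stmt10 (n : ℕ) (hn : 0 < n) (a : ℕ → ℝ)
    (ha : ∀ i ∈ Finset.Icc 1 n, 0 < a i) :
    Real.sqrt (∑ k ∈ Finset.Icc 1 n, a k) ≤
        ∑ i ∈ Finset.Icc 1 n, a i / Real.sqrt (∑ k ∈ Finset.Icc 1 i, a k) ∧
      ∑ i ∈ Finset.Icc 1 n, a i / Real.sqrt (∑ k ∈ Finset.Icc 1 i, a k) ≤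
        2 * Real.sqrt (∑ k ∈ Finset.Icc 1 n, a k) := by
  clear hn
  induction n with
  | zero => simp
  | succ m ih =>
    have ha' : ∀ i ∈ Finset.Icc 1 m, 0 < a i := fun i hi =>
      ha i (Finset.mem_Icc.2 ⟨(Finset.mem_Icc.1 hi).1, (Finset.mem_Icc.1 hi).2.trans (Nat.le_succ m)⟩)
    obtain ⟨h1, h2⟩ := ih ha'
    have hx : 0 < a (m + 1) := ha (m + 1) (Finset.mem_Icc.2 ⟨by omega, le_refl _⟩)
    have hS : 0 ≤ ∑ k ∈ Finset.Icc 1 m, a k := Finset.sum_nonneg fun i hi => (ha' i hi).le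
    have hT : ∑ k ∈ Finset.Icc 1 (m + 1), a k = ∑ k ∈ Finset.Icc 1 m, a k + a (m + 1) :=
      Finset.sum_Icc_succ_top (by omega) _
    rw [Finset.sum_Icc_succ_top (by omega : 1 ≤ m + 1)
      (fun i => a i / Real.sqrt (∑ k ∈ Finset.Icc 1 i, a k)), hT]
    have hs := Real.sq_sqrt hS
    have hs0 := Real.sqrt_nonneg (∑ k ∈ Finset.Icc 1 m, a k)
    have ht := Real.sq_sqrt (add_nonneg hS hx.le)
    have ht0 := Real.sqrt_pos.2 (add_pos_of_nonneg_of_pos hS hx)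
    generalize Real.sqrt (∑ k ∈ Finset.Icc 1 m, a k + a (m + 1)) = t at *
    generalize Real.sqrt (∑ k ∈ Finset.Icc 1 m, a k) = s at *
    have hst : s ≤ t := by nlinarith
    have e1 : t - s ≤ a (m + 1) / t := by
      rw [le_div_iff₀ ht0]; nlinarith
    have e2 : a (m + 1) / t ≤ 2 * (t - s) := by
      rw [div_le_iff₀ ht0]; nlinarith [sq_nonneg (t - s)]
    constructor <;> linarith
end

section
/- Let F : ℝ^d → ℝ be L-smooth, let η > 0, τ_2 > 0, and let m ∈ ℝ^d with m ≠ 0 and ‖m‖ ≥ τ_2. Let w ∈ ℝ^d and w' = w − η·τ_2·m/‖m‖. Then ‖∇F(w)‖ ≤ 3·(F(w) − F(w'))/(η·τ_2) + 4·‖m − ∇F(w)‖ + (3L/2)·η·τ_2, where ‖·‖ is the Euclidean norm. -/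
theorem descent_aux {d : ℕ} (F : EuclideanSpace ℝ (Fin d) → ℝ) (L : ℝ)
    (hdiff : Differentiable ℝ F)
    (hsmooth : ∀ u v : EuclideanSpace ℝ (Fin d),
      ‖gradient F u - gradient F v‖ ≤ L * ‖u - v‖)
    (w v : EuclideanSpace ℝ (Fin d)) :
    F (w + v) ≤ F w + inner ℝ (gradient F w) v + L / 2 * ‖v‖ ^ 2 := by
  have h1 : ∀ t : ℝ, HasDerivAt (fun t : ℝ => F (w + t • v))
      (inner ℝ (gradient F (w + t • v)) v) t := by
    intro t
    have hg := (hdiff (w + t • v)).hasGradientAt.hasFDerivAt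
    have hl : HasDerivAt (fun t : ℝ => w + t • v) v t := by
      simpa using ((hasDerivAt_id t).smul_const v).const_add w
    exact hg.comp_hasDerivAt t hl
  have h2 : ∀ t : ℝ, HasDerivAt
      (fun t : ℝ => F w + t * inner ℝ (gradient F w) v + L / 2 * ‖v‖ ^ 2 * t ^ 2)
      (inner ℝ (gradient F w) v + L * ‖v‖ ^ 2 * t) t := by
    intro t
    have h := (((hasDerivAt_id t).mul_const (inner ℝ (gradient F w) v)).const_add (F w)).add
      (((hasDerivAt_id t).pow 2).const_mul (L / 2 * ‖v‖ ^ 2))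
    refine h.congr_deriv ?_
    simp
    ring
  have h := image_le_of_deriv_right_le_deriv_boundary (a := (0 : ℝ)) (b := 1)
    (fun t _ => (h1 t).continuousAt.continuousWithinAt)
    (fun t _ => (h1 t).hasDerivWithinAt)
    (by simp)
    (fun t _ => (h2 t).continuousAt.continuousWithinAt)
    (fun t _ => (h2 t).hasDerivWithinAt)
    (by
      intro t ht
      have a := real_inner_le_norm (gradient F (w + t • v) - gradient F w) v
      rw [inner_sub_left] at a
      have b := hsmooth (w + t • v) w
      rw [add_sub_cancel_left, norm_smul, Real.norm_of_nonneg ht.1] at b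
      have c := mul_le_mul_of_nonneg_right b (norm_nonneg v)
      nlinarith)
    (Set.right_mem_Icc.2 zero_le_one)
  simpa using h

/-- **One step of clipped-momentum SGD, large-momentum case.** If `F` is `L`-smooth,
`‖m‖ ≥ τ₂ > 0`, and `w' = w - η • (τ₂ / ‖m‖) • m`, then
`‖∇F(w)‖ ≤ 3 (F w - F w') / (η τ₂) + 4 ‖m - ∇F(w)‖ + (3L/2) η τ₂`. -/
theorem stmt13 {d : ℕ} (F : EuclideanSpace ℝ (Fin d) → ℝ) (L : ℝ) (hL : 0 < L)
    (hdiff : Differentiable ℝ F)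
    (hsmooth : ∀ u v : EuclideanSpace ℝ (Fin d),
      ‖gradient F u - gradient F v‖ ≤ L * ‖u - v‖)
    (η τ₂ : ℝ) (hη : 0 < η) (hτ₂ : 0 < τ₂)
    (m w w' : EuclideanSpace ℝ (Fin d)) (hm : m ≠ 0) (hmτ : τ₂ ≤ ‖m‖)
    (hw' : w' = w - (η * τ₂ / ‖m‖) • m) :
    ‖gradient F w‖ ≤ 3 * (F w - F w') / (η * τ₂) + 4 * ‖m - gradient F w‖
      + (3 * L / 2) * η * τ₂ := by
  have hM : 0 < ‖m‖ := norm_pos_iff.2 hm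
  have hs : 0 < η * τ₂ := mul_pos hη hτ₂
  have hd := descent_aux F L hdiff hsmooth w (-((η * τ₂ / ‖m‖) • m))
  rw [← sub_eq_add_neg, ← hw', norm_neg, norm_smul, inner_neg_right, inner_smul_right,
    Real.norm_of_nonneg (by positivity), div_mul_cancel₀ _ hM.ne'] at hd
  have hi := real_inner_le_norm (m - gradient F w) m
  rw [inner_sub_left, real_inner_self_eq_norm_sq] at hi
  have hk : ‖m‖ - ‖m - gradient F w‖ ≤ inner ℝ (gradient F w) m / ‖m‖ := by
    rw [le_div_iff₀ hM]; nlinarith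
  have hk2 := mul_le_mul_of_nonneg_left hk hs.le
  have e1 : η * τ₂ / ‖m‖ * inner ℝ (gradient F w) m
      = η * τ₂ * (inner ℝ (gradient F w) m / ‖m‖) := by ring
  rw [e1] at hd
  have hA : ‖m‖ - ‖m - gradient F w‖ - L / 2 * (η * τ₂) ≤ (F w - F w') / (η * τ₂) := by
    rw [le_div_iff₀ hs]; nlinarith
  have ht : ‖gradient F w‖ ≤ ‖m‖ + ‖m - gradient F w‖ := by
    simpa using norm_sub_le m (m - gradient F w)
  rw [mul_div_assoc]
  linarith
end

section
/- Let F : ℝ^d → ℝ be L-smooth, let η > 0, τ_2 > 0, and let m ∈ ℝ^d with ‖m‖ ≤ τ_2. Let w ∈ ℝ^d and w' = w − η·m. Then ‖∇F(w)‖² ≤ 2·(F(w) − F(w'))/η + ‖∇F(w) − m‖² + L·η·τ_2², where ‖·‖ is the Euclidean norm. -/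
/-- **One step of clipped-momentum SGD, small-momentum case.** If `F` is `L`-smooth,
`‖m‖ ≤ τ₂`, and `w' = w - η • m`, then
`‖∇F(w)‖² ≤ 2 (F w - F w') / η + ‖∇F(w) - m‖² + L η τ₂²`. -/
theorem stmt14 {d : ℕ} (F : EuclideanSpace ℝ (Fin d) → ℝ) (L : ℝ) (hL : 0 < L)
    (hdiff : Differentiable ℝ F)
    (hsmooth : ∀ u v : EuclideanSpace ℝ (Fin d),
      ‖gradient F u - gradient F v‖ ≤ L * ‖u - v‖)
    (η τ₂ : ℝ) (hη : 0 < η) (hτ₂ : 0 < τ₂)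
    (m w w' : EuclideanSpace ℝ (Fin d)) (hmτ : ‖m‖ ≤ τ₂)
    (hw' : w' = w - η • m) :
    ‖gradient F w‖ ^ 2 ≤ 2 * (F w - F w') / η + ‖gradient F w - m‖ ^ 2
      + L * η * τ₂ ^ 2 := by
  set g := gradient F w with hg
  have hφ : ∀ t : ℝ, HasDerivAt (fun t : ℝ => F (w - t • m) + t * inner ℝ g m
      - L * ‖m‖ ^ 2 / 2 * t ^ 2)
      (-(inner ℝ (gradient F (w - t • m)) m) + inner ℝ g m - L * ‖m‖ ^ 2 * t) t := by
    intro t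
    have h1 : HasDerivAt (fun t : ℝ => w - t • m) (-m) t := by
      simpa using ((hasDerivAt_id t).smul_const m).const_sub w
    have h2 := ((hdiff (w - t • m)).hasGradientAt.hasFDerivAt).comp_hasDerivAt t h1
    have h3 := (h2.add ((hasDerivAt_id t).mul_const (inner ℝ g m))).sub
      ((hasDerivAt_pow 2 t).const_mul (L * ‖m‖ ^ 2 / 2))
    refine HasDerivAt.congr_deriv (f := fun t : ℝ => F (w - t • m) + t * inner ℝ g m
      - L * ‖m‖ ^ 2 / 2 * t ^ 2) h3 ?_
    simp
    ring
  have hanti : AntitoneOn (fun t : ℝ => F (w - t • m) + t * inner ℝ g m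
      - L * ‖m‖ ^ 2 / 2 * t ^ 2) (Set.Ici 0) := by
    apply antitoneOn_of_deriv_nonpos (convex_Ici 0)
    · exact fun t _ => (hφ t).continuousAt.continuousWithinAt
    · exact fun t _ => (hφ t).differentiableAt.differentiableWithinAt
    · intro t ht
      rw [interior_Ici] at ht
      have ht0 : 0 < t := ht
      rw [(hφ t).deriv]
      have h1 := real_inner_le_norm (g - gradient F (w - t • m)) m
      have h2 := hsmooth w (w - t • m)
      rw [sub_sub_cancel, norm_smul, Real.norm_of_nonneg ht0.le] at h2
      have h3 := mul_le_mul_of_nonneg_right h2 (norm_nonneg m)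
      rw [inner_sub_left] at h1
      nlinarith
  have hd := hanti (Set.mem_Ici.2 le_rfl) (Set.mem_Ici.2 hη.le) hη.le
  simp only [zero_smul, sub_zero, ← hw'] at hd
  have hn := norm_sub_sq_real g m
  have hm2 : ‖m‖ ^ 2 ≤ τ₂ ^ 2 := by gcongr
  have h5 : 2 * inner ℝ g m - L * η * ‖m‖ ^ 2 ≤ 2 * (F w - F w') / η := by
    rw [le_div_iff₀ hη]
    nlinarith
  have h6 : L * η * ‖m‖ ^ 2 ≤ L * η * τ₂ ^ 2 := by gcongr
  nlinarith [sq_nonneg ‖m‖]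
end

section
/- Let T be a positive integer, G_0 ≥ 1, τ > 0, and g_1,…,g_T ∈ ℝ^d with ‖g_t‖ ≤ τ for all t. Define w_1 ∈ ℝ^d, η_t = 1/√(G_0² + Σ_{k=1}^t ‖g_k‖²), w_{t+1} = w_t − η_t·g_t for t = 1,…,T. Then ‖w_{T+1} − w_1‖² ≤ T·(1 + log(1 + T·τ²)), where ‖·‖ is the Euclidean norm. -/
/-- **Displacement bound for AdaGrad-type iterates with bounded updates.** If `‖g_t‖ ≤ τ` for
all `t`, `G₀ ≥ 1`, and `w_{t+1} = w_t - η_t • g_t` with `η_t = 1/√(G₀² + ∑_{k=1}^t ‖g_k‖²)`,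
then `‖w_{T+1} - w_1‖² ≤ T (1 + log(1 + T τ²))`. -/
theorem stmt16 {d : ℕ} (T : ℕ) (hT : 0 < T) (G₀ τ : ℝ) (hG₀ : 1 ≤ G₀) (hτ : 0 < τ)
    (g : ℕ → EuclideanSpace ℝ (Fin d)) (hg : ∀ t, 1 ≤ t → t ≤ T → ‖g t‖ ≤ τ)
    (w : ℕ → EuclideanSpace ℝ (Fin d))
    (hrec : ∀ t, 1 ≤ t → t ≤ T →
      w (t + 1) = w t - (1 / Real.sqrt (G₀ ^ 2 + ∑ k ∈ Finset.Icc 1 t, ‖g k‖ ^ 2)) • g t) :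
    ‖w (T + 1) - w 1‖ ^ 2 ≤ (T : ℝ) * (1 + Real.log (1 + (T : ℝ) * τ ^ 2)) := by
  set S : ℕ → ℝ := fun t => G₀ ^ 2 + ∑ k ∈ Finset.Icc 1 t, ‖g k‖ ^ 2 with hS
  have hG : (1 : ℝ) ≤ G₀ ^ 2 := by nlinarith
  have hS1 : ∀ t, G₀ ^ 2 ≤ S t := fun t =>
    le_add_of_nonneg_right (Finset.sum_nonneg fun _ _ => sq_nonneg _)
  have hSs : ∀ t, S (t + 1) = S t + ‖g (t + 1)‖ ^ 2 := by
    intro t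
    simp only [hS]
    rw [Finset.sum_Icc_succ_top (by omega)]
    ring
  have key : ∀ n : ℕ, n ≤ T →
      ‖w (n + 1) - w 1‖ ^ 2 ≤ (n : ℝ) * (Real.log (S n) - Real.log (G₀ ^ 2)) := by
    intro n
    induction n with
    | zero => intro _; simp
    | succ n ih =>
      intro hn
      have ih := ih (by omega)
      have hp : 0 < S n := by linarith [hS1 n]
      have hp' : 0 < S (n + 1) := by linarith [hS1 (n + 1)]
      have hL : 0 ≤ Real.log (S n) - Real.log (G₀ ^ 2) :=
        sub_nonneg.2 (Real.log_le_log (by linarith) (hS1 n))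
      have hr : w (n + 1 + 1) = w (n + 1) - (1 / Real.sqrt (S (n + 1))) • g (n + 1) :=
        hrec (n + 1) (by omega) hn
      set b := ‖(1 / Real.sqrt (S (n + 1))) • g (n + 1)‖ with hb
      have hb2 : b ^ 2 ≤ Real.log (S (n + 1)) - Real.log (S n) := by
        have h1 : b ^ 2 = 1 - S n / S (n + 1) := by
          rw [hb, norm_smul, mul_pow, Real.norm_eq_abs, sq_abs, div_pow, Real.sq_sqrt hp'.le]
          field_simp
          rw [hSs n]; ring
        have h2 := Real.log_le_sub_one_of_pos (div_pos hp hp')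
        rw [Real.log_div hp.ne' hp'.ne'] at h2
        linarith
      have hb0 : 0 ≤ b := norm_nonneg _
      have htri : ‖w (n + 1 + 1) - w 1‖ ≤ ‖w (n + 1) - w 1‖ + b := by
        rw [hr, sub_right_comm]
        exact norm_sub_le _ _
      have ha0 : 0 ≤ ‖w (n + 1) - w 1‖ := norm_nonneg _
      set a := ‖w (n + 1) - w 1‖
      set L := Real.log (S n) - Real.log (G₀ ^ 2) with hLd
      set L' := Real.log (S (n + 1)) - Real.log (S n) with hLd'
      have hL' : 0 ≤ L' := (sq_nonneg b).trans hb2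
      have hn0 : (0 : ℝ) ≤ n := Nat.cast_nonneg n
      have hab : 2 * (a * b) ≤ L + n * L' := by
        refine le_of_abs_le (abs_le_of_sq_le_sq ?_ (by positivity))
        have h3 : a ^ 2 * b ^ 2 ≤ (n * L) * L' :=
          mul_le_mul ih hb2 (sq_nonneg b) (by positivity)
        nlinarith [sq_nonneg (L - n * L')]
      have h4 : ‖w (n + 1 + 1) - w 1‖ ^ 2 ≤ (a + b) ^ 2 :=
        pow_le_pow_left₀ (norm_nonneg _) htri 2
      have h5 : Real.log (S (n + 1)) - Real.log (G₀ ^ 2) = L + L' := by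
        rw [hLd, hLd']; ring
      rw [h5]
      push_cast
      nlinarith
  refine (key T le_rfl).trans (mul_le_mul_of_nonneg_left ?_ (Nat.cast_nonneg T))
  have hsum : ∑ k ∈ Finset.Icc 1 T, ‖g k‖ ^ 2 ≤ T * τ ^ 2 := by
    have h := Finset.sum_le_card_nsmul (Finset.Icc 1 T) (fun k => ‖g k‖ ^ 2) (τ ^ 2)
      (fun k hk => by
        have hk := Finset.mem_Icc.1 hk
        exact pow_le_pow_left₀ (norm_nonneg _) (hg k hk.1 hk.2) 2)
    simpa using h
  have hq : 0 ≤ (T : ℝ) * τ ^ 2 := by positivity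
  have hST : S T ≤ G₀ ^ 2 * (1 + T * τ ^ 2) := by
    have : S T = G₀ ^ 2 + ∑ k ∈ Finset.Icc 1 T, ‖g k‖ ^ 2 := rfl
    nlinarith
  have h6 := Real.log_le_log (by linarith [hS1 T]) hST
  rw [Real.log_mul (by positivity) (by positivity)] at h6
  linarith
end

section
/- Let (Ω, 𝔉, ℙ) be a probability space with a filtration (𝔉_t)_{t≥0}, let α ∈ (1,2], G > 0, τ > 0, and let T be a positive integer with τ ≤ T^{1/α}. Let X_1,…,X_T be random vectors in ℝ^d such that X_t is 𝔉_t-measurable, ‖X_t‖ ≤ τ almost surely, and E[‖X_t‖^α | 𝔉_{t−1}] ≤ G^α almost surely for every t. Let Y_t = ‖X_t − E[X_t | 𝔉_{t−1}]‖². Then for every δ ∈ (0,1), with probability at least 1 − δ, Σ_{t=1}^T (Y_t − E[Y_t | 𝔉_{t−1}]) ≤ √T·τ^{2−α/2}·G^α + 4·√T·τ^{2−α/2}·log(1/δ), where ‖·‖ is the Euclidean norm. -/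
open MeasureTheory

lemma aux_int {Ω : Type*} {m : MeasurableSpace Ω} (μ : Measure Ω) [IsProbabilityMeasure μ]
    {E : Type*} [NormedAddCommGroup E] {f : Ω → E} (hf : AEStronglyMeasurable f μ) (C : ℝ)
    (h : ∀ᵐ ω ∂μ, ‖f ω‖ ≤ C) : Integrable f μ := Integrable.of_bound hf C h

/-- conditional second moment of the deviation is at most the conditional second moment -/
lemma aux_vec {Ω : Type*} {m : MeasurableSpace Ω} (μ : Measure Ω) [IsProbabilityMeasure μ]
    (d : ℕ) (F : MeasurableSpace Ω) (hF : F ≤ m) (X : Ω → EuclideanSpace ℝ (Fin d)) (τ : ℝ)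
    (hX : AEStronglyMeasurable[m] X μ) (hb : ∀ᵐ ω ∂μ, ‖X ω‖ ≤ τ) :
    μ[fun ω => ‖X ω - (μ[X | F]) ω‖ ^ 2 | F] ≤ᵐ[μ] μ[fun ω => ‖X ω‖ ^ 2 | F] := by
  set M := μ[X | F] with hM
  have hMb : ∀ᵐ ω ∂μ, ‖M ω‖ ≤ τ := ae_bdd_norm_condExp_of_ae_bdd_norm hb
  have hMm : StronglyMeasurable[F] M := stronglyMeasurable_condExp
  have hMa : AEStronglyMeasurable[m] M μ := (hMm.mono hF).aestronglyMeasurable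
  have hXi : Integrable X μ := aux_int μ hX τ hb
  have i1 : Integrable (fun ω => ‖X ω‖ ^ 2) μ := by
    refine aux_int μ (hX.norm.pow 2) (τ ^ 2) ?_
    filter_upwards [hb] with ω h
    rw [Real.norm_of_nonneg (by positivity)]
    gcongr
  have i2 : Integrable (fun ω => ‖M ω‖ ^ 2) μ := by
    refine aux_int μ (hMa.norm.pow 2) (τ ^ 2) ?_
    filter_upwards [hMb] with ω h
    rw [Real.norm_of_nonneg (by positivity)]
    gcongr
  have i3 : Integrable (fun ω => innerSL ℝ (M ω) (X ω)) μ := by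
    refine aux_int μ (hMa.inner hX) (τ * τ) ?_
    filter_upwards [hb, hMb] with ω h h'
    refine (norm_inner_le_norm (𝕜 := ℝ) (M ω) (X ω)).trans ?_
    have := norm_nonneg (X ω)
    gcongr
    linarith
  have hp := condExp_bilin_of_stronglyMeasurable_left (innerSL ℝ) hMm i3 hXi
  have e : (fun ω => ‖X ω - M ω‖ ^ 2) = ((fun ω => ‖X ω‖ ^ 2) + (fun ω => ‖M ω‖ ^ 2))
      - (2:ℝ) • (fun ω => innerSL ℝ (M ω) (X ω)) := by
    funext ω
    simp only [Pi.add_apply, Pi.sub_apply, Pi.smul_apply, innerSL_apply_apply, smul_eq_mul]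
    rw [norm_sub_sq_real, real_inner_comm]
    ring
  rw [e]
  have e2 : μ[fun ω => ‖M ω‖ ^ 2 | F] = fun ω => ‖M ω‖ ^ 2 :=
    condExp_of_stronglyMeasurable hF (hMm.norm.pow 2) i2
  filter_upwards [condExp_sub (m := F) (i1.add i2) (i3.smul (2:ℝ)), condExp_add (m := F) i1 i2,
    condExp_smul (μ := μ) (2:ℝ) (fun ω => innerSL ℝ (M ω) (X ω)) F, hp] with ω h1 h2 h3 h4
  rw [h1, Pi.sub_apply, h2, h3, Pi.add_apply, Pi.smul_apply, h4, e2]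
  have h5 : innerSL ℝ (M ω) (M ω) = ‖M ω‖ ^ 2 := real_inner_self_eq_norm_sq (M ω)
  simp only [← hM, smul_eq_mul]
  rw [h5]
  nlinarith [sq_nonneg ‖M ω‖]

/-- conditional exponential moment -/
lemma aux_exp {Ω : Type*} {m : MeasurableSpace Ω} (μ : Measure Ω) [IsProbabilityMeasure μ]
    (F : MeasurableSpace Ω) (hF : F ≤ m) (Y : Ω → ℝ) (B l v : ℝ) (hl : 0 ≤ l)
    (hlB : l * B ≤ 1)
    (hY : AEStronglyMeasurable[m] Y μ) (h0 : ∀ᵐ ω ∂μ, 0 ≤ Y ω) (hB : ∀ᵐ ω ∂μ, Y ω ≤ B)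
    (hv : ∀ᵐ ω ∂μ, (μ[fun ω => Y ω ^ 2 | F]) ω ≤ v) :
    (∀ᵐ ω ∂μ, |Y ω - (μ[Y | F]) ω| ≤ B) ∧
    ∀ᵐ ω ∂μ, (μ[fun ω => Real.exp (l * (Y ω - (μ[Y | F]) ω)) | F]) ω ≤ Real.exp (l ^ 2 * v) := by
  have hYi : Integrable Y μ := by
    refine aux_int μ hY B ?_
    filter_upwards [h0, hB] with ω h1 h2
    rwa [Real.norm_of_nonneg h1]
  have hM0 : ∀ᵐ ω ∂μ, 0 ≤ (μ[Y | F]) ω := condExp_nonneg h0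
  have hMB : ∀ᵐ ω ∂μ, (μ[Y | F]) ω ≤ B := by
    have := condExp_mono (m := F) hYi (integrable_const B) hB
    rwa [condExp_const hF] at this
  have hZ : ∀ᵐ ω ∂μ, |Y ω - (μ[Y | F]) ω| ≤ B := by
    filter_upwards [h0, hB, hM0, hMB] with ω a b c d
    rw [abs_le]; constructor <;> linarith
  refine ⟨hZ, ?_⟩
  set Z : Ω → ℝ := Y - μ[Y | F] with hZdef
  have hZm : AEStronglyMeasurable[m] Z μ :=
    hY.sub (stronglyMeasurable_condExp.mono hF).aestronglyMeasurable
  have hZi : Integrable Z μ := hYi.sub integrable_condExp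
  have hZ2 : Integrable (Z ^ 2) μ := by
    refine aux_int μ (hZm.pow 2) (B ^ 2) ?_
    filter_upwards [hZ] with ω h
    simp only [Pi.pow_apply, norm_pow]
    exact pow_le_pow_left₀ (norm_nonneg _) h 2
  have hlZ : ∀ᵐ ω ∂μ, |l * Z ω| ≤ 1 := by
    filter_upwards [hZ] with ω h
    rw [abs_mul, abs_of_nonneg hl]
    exact (mul_le_mul_of_nonneg_left h hl).trans hlB
  have hei : Integrable (fun ω => Real.exp (l * Z ω)) μ := by
    refine aux_int μ (Real.continuous_exp.comp_aestronglyMeasurable (hZm.const_mul l)) (Real.exp 1) ?_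
    filter_upwards [hlZ] with ω h
    rw [Real.norm_of_nonneg (Real.exp_pos _).le]
    exact Real.exp_le_exp.2 ((le_abs_self _).trans h)
  have hmem : MemLp Y 2 μ := by
    refine MemLp.of_bound hY B ?_
    filter_upwards [h0, hB] with ω h1 h2
    rwa [Real.norm_of_nonneg h1]
  have hvar : μ[Z ^ 2 | F] ≤ᵐ[μ] μ[Y ^ 2 | F] := ProbabilityTheory.condVar_ae_le_condExp_sq hF hmem
  have hle : (fun ω => Real.exp (l * Z ω)) ≤ᵐ[μ] ((fun _ => (1:ℝ)) + l • Z) + (l ^ 2) • (Z ^ 2) := by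
    filter_upwards [hlZ] with ω h
    have := (abs_le.1 (Real.abs_exp_sub_one_sub_id_le h)).2
    simp only [Pi.add_apply, Pi.smul_apply, smul_eq_mul, Pi.pow_apply]
    nlinarith
  have i1 : Integrable (fun _ : Ω => (1:ℝ)) μ := integrable_const _
  have hmono := condExp_mono (m := F) hei ((i1.add (hZi.smul l)).add (hZ2.smul (l ^ 2))) hle
  have hc1 : μ[fun _ : Ω => (1:ℝ) | F] = fun _ => 1 := condExp_const hF 1
  have hcc : μ[μ[Y | F] | F] = μ[Y | F] :=
    condExp_of_stronglyMeasurable hF stronglyMeasurable_condExp integrable_condExp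
  have hZ0 := condExp_sub (m := F) hYi (integrable_condExp (m := F) (f := Y) (μ := μ))
  filter_upwards [hmono, condExp_add (m := F) (i1.add (hZi.smul l)) (hZ2.smul (l ^ 2)),
    condExp_add (m := F) i1 (hZi.smul l), condExp_smul (μ := μ) l Z F,
    condExp_smul (μ := μ) (l ^ 2) (Z ^ 2) F, hZ0, hvar, hv] with ω g1 g2 g3 g4 g5 g6 g7 g8
  have g8' : (μ[Y ^ 2 | F]) ω ≤ v := g8
  rw [hcc] at g6
  rw [g2, Pi.add_apply, g3, Pi.add_apply, g4, g5, hc1, Pi.smul_apply, Pi.smul_apply, g6] at g1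
  simp only [Pi.sub_apply, sub_self, smul_eq_mul, mul_zero, add_zero] at g1
  have k : l ^ 2 * (μ[Z ^ 2 | F]) ω ≤ l ^ 2 * v :=
    mul_le_mul_of_nonneg_left (g7.trans g8') (sq_nonneg l)
  refine le_trans g1 ?_
  linarith [Real.add_one_le_exp (l ^ 2 * v)]

/-- supermartingale induction -/
lemma aux_ind {Ω : Type*} {m : MeasurableSpace Ω} (μ : Measure Ω) [IsProbabilityMeasure μ]
    (𝔉 : ℕ → MeasurableSpace Ω) (hmono : Monotone 𝔉) (hle : ∀ k, 𝔉 k ≤ m) (T : ℕ)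
    (Z : ℕ → Ω → ℝ) (l B c : ℝ) (hl : 0 ≤ l)
    (hZm : ∀ t, 1 ≤ t → t ≤ T → StronglyMeasurable[𝔉 t] (Z t))
    (hZb : ∀ t, 1 ≤ t → t ≤ T → ∀ᵐ ω ∂μ, |Z t ω| ≤ B)
    (hZe : ∀ t, 1 ≤ t → t ≤ T →
      ∀ᵐ ω ∂μ, (μ[fun ω => Real.exp (l * Z t ω) | 𝔉 (t - 1)]) ω ≤ Real.exp c)
    (n : ℕ) (hn : n ≤ T) :
    StronglyMeasurable[𝔉 n] (fun ω => ∑ t ∈ Finset.Icc 1 n, Z t ω) ∧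
    (∀ᵐ ω ∂μ, |∑ t ∈ Finset.Icc 1 n, Z t ω| ≤ n * B) ∧
    Integrable (fun ω => Real.exp (l * ∑ t ∈ Finset.Icc 1 n, Z t ω)) μ ∧
    ∫ ω, Real.exp (l * ∑ t ∈ Finset.Icc 1 n, Z t ω) ∂μ ≤ Real.exp (n * c) := by
  induction n with
  | zero => simp [stronglyMeasurable_const]
  | succ n ih =>
    obtain ⟨a1, a2, a3, a4⟩ := ih (by omega)
    have h1 : 1 ≤ n + 1 := by omega
    have b1 := hZm (n + 1) h1 hn
    have b2 := hZb (n + 1) h1 hn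
    have b3 := hZe (n + 1) h1 hn
    simp only [Nat.add_sub_cancel] at b3
    simp only [Finset.sum_Icc_succ_top h1]
    have c1 : StronglyMeasurable[𝔉 (n + 1)] (fun ω => ∑ t ∈ Finset.Icc 1 n, Z t ω + Z (n + 1) ω) :=
      (a1.mono (hmono (Nat.le_succ n))).add b1
    have c2 : ∀ᵐ ω ∂μ, |∑ t ∈ Finset.Icc 1 n, Z t ω + Z (n + 1) ω| ≤ ((n + 1 : ℕ) : ℝ) * B := by
      filter_upwards [a2, b2] with ω g1 g2
      push_cast
      linarith [abs_add_le (∑ t ∈ Finset.Icc 1 n, Z t ω) (Z (n + 1) ω)]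
    have c3 : Integrable (fun ω => Real.exp (l * (∑ t ∈ Finset.Icc 1 n, Z t ω + Z (n + 1) ω))) μ := by
      refine aux_int μ (Real.continuous_exp.comp_aestronglyMeasurable
        ((c1.mono (hle _)).aestronglyMeasurable.const_mul l)) (Real.exp (l * (((n + 1 : ℕ) : ℝ) * B))) ?_
      filter_upwards [c2] with ω h
      rw [Real.norm_of_nonneg (Real.exp_pos _).le]
      exact Real.exp_le_exp.2 (mul_le_mul_of_nonneg_left ((le_abs_self _).trans h) hl)
    refine ⟨c1, c2, c3, ?_⟩
    have d1 : Integrable (fun ω => Real.exp (l * Z (n + 1) ω)) μ := by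
      refine aux_int μ (Real.continuous_exp.comp_aestronglyMeasurable
        ((b1.mono (hle _)).aestronglyMeasurable.const_mul l)) (Real.exp (l * B)) ?_
      filter_upwards [b2] with ω h
      rw [Real.norm_of_nonneg (Real.exp_pos _).le]
      exact Real.exp_le_exp.2 (mul_le_mul_of_nonneg_left ((le_abs_self _).trans h) hl)
    set W : Ω → ℝ := fun ω => Real.exp (l * ∑ t ∈ Finset.Icc 1 n, Z t ω) with hW
    set V : Ω → ℝ := fun ω => Real.exp (l * Z (n + 1) ω) with hV
    have e : (fun ω => Real.exp (l * (∑ t ∈ Finset.Icc 1 n, Z t ω + Z (n + 1) ω))) = W * V := by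
      funext ω
      simp only [Pi.mul_apply, hW, hV]
      rw [← Real.exp_add, mul_add]
    rw [e] at c3 ⊢
    have hWm : StronglyMeasurable[𝔉 n] W :=
      Real.continuous_exp.comp_stronglyMeasurable (a1.const_mul l)
    have p := condExp_mul_of_stronglyMeasurable_left hWm c3 d1
    rw [← integral_condExp (hle n)]
    calc ∫ ω, (μ[W * V | 𝔉 n]) ω ∂μ ≤ ∫ ω, W ω * Real.exp c ∂μ := by
          refine integral_mono_ae integrable_condExp (a3.mul_const _) ?_
          filter_upwards [p, b3] with ω g1 g2
          rw [g1, Pi.mul_apply]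
          exact mul_le_mul_of_nonneg_left g2 (Real.exp_pos _).le
      _ = (∫ ω, W ω ∂μ) * Real.exp c := integral_mul_const _ _
      _ ≤ Real.exp (n * c) * Real.exp c := by gcongr
      _ = _ := by rw [← Real.exp_add]; push_cast; ring_nf

/-- **Martingale fluctuation of squared deviations of bounded random vectors with bounded
conditional `α`-th moments.** If `‖X_t‖ ≤ τ` a.s., `E[‖X_t‖^α | 𝔉_{t-1}] ≤ G^α` a.s. and
`τ ≤ T^(1/α)`, then with `Y_t = ‖X_t - E[X_t | 𝔉_{t-1}]‖²`, for every `δ ∈ (0,1)`, with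
probability at least `1 - δ`,
`∑_{t=1}^T (Y_t - E[Y_t | 𝔉_{t-1}]) ≤ √T τ^(2-α/2) G^α + 4 √T τ^(2-α/2) log(1/δ)`. -/
theorem stmt17 {Ω : Type*} {m : MeasurableSpace Ω} (ℙ : Measure Ω) [IsProbabilityMeasure ℙ]
    (d : ℕ) (𝔉 : ℕ → MeasurableSpace Ω) (h𝔉mono : Monotone 𝔉) (h𝔉le : ∀ k, 𝔉 k ≤ m)
    (α G τ : ℝ) (hα1 : 1 < α) (hα2 : α ≤ 2) (hG : 0 < G) (hτ : 0 < τ)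
    (T : ℕ) (hT : 0 < T) (hττ : τ ≤ (T : ℝ) ^ (1 / α))
    (X : ℕ → Ω → EuclideanSpace ℝ (Fin d))
    (hmeas : ∀ t, 1 ≤ t → t ≤ T → Measurable[𝔉 t] (X t))
    (hbdd : ∀ t, 1 ≤ t → t ≤ T → ∀ᵐ ω ∂ℙ, ‖X t ω‖ ≤ τ)
    (hmom : ∀ t, 1 ≤ t → t ≤ T →
      ∀ᵐ ω ∂ℙ, (ℙ[fun ω' => ‖X t ω'‖ ^ α | 𝔉 (t - 1)]) ω ≤ G ^ α)
    (Y : ℕ → Ω → ℝ)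
    (hY : ∀ t ω, Y t ω = ‖X t ω - (ℙ[X t | 𝔉 (t - 1)]) ω‖ ^ 2)
    (δ : ℝ) (hδ : δ ∈ Set.Ioo (0 : ℝ) 1) :
    ENNReal.ofReal (1 - δ) ≤
      ℙ {ω | ∑ t ∈ Finset.Icc 1 T, (Y t ω - (ℙ[Y t | 𝔉 (t - 1)]) ω) ≤
        Real.sqrt T * τ ^ (2 - α / 2) * G ^ α
          + 4 * Real.sqrt T * τ ^ (2 - α / 2) * Real.log (1 / δ)} := by
  obtain ⟨hδ0, hδ1⟩ := hδ
  have hTR : (0:ℝ) < T := by exact_mod_cast hT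
  set P : ℝ := τ ^ (2 - α / 2) with hP
  have hP0 : 0 < P := Real.rpow_pos_of_pos hτ _
  set s : ℝ := Real.sqrt T with hs
  have hs0 : 0 < s := Real.sqrt_pos.2 hTR
  have hs2 : s ^ 2 = T := Real.sq_sqrt hTR.le
  have hGα : 0 < G ^ α := Real.rpow_pos_of_pos hG _
  set l : ℝ := 1 / (4 * s * P) with hl
  have hl0 : 0 < l := by positivity
  have hτα : τ ^ (α / 2) ≤ s := by
    have h1 : τ ^ (α / 2) ≤ ((T : ℝ) ^ (1 / α)) ^ (α / 2) :=
      Real.rpow_le_rpow hτ.le hττ (by linarith)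
    rwa [← Real.rpow_mul hTR.le, show 1 / α * (α / 2) = 1 / 2 by field_simp,
      ← Real.sqrt_eq_rpow] at h1
  have hττ2 : τ ^ 2 = P * τ ^ (α / 2) := by
    rw [hP, ← Real.rpow_add hτ, ← Real.rpow_natCast]; norm_num
  have hlB : l * (4 * τ ^ 2) ≤ 1 := by
    rw [hl, hττ2, one_div, inv_mul_le_iff₀ (by positivity)]
    nlinarith [mul_le_mul_of_nonneg_left hτα hP0.le]
  have hP2 : τ ^ 2 * τ ^ (2 - α) = P ^ 2 := by
    rw [hP, ← Real.rpow_natCast, ← Real.rpow_natCast, ← Real.rpow_add hτ, ← Real.rpow_mul hτ.le]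
    congr 1; push_cast; ring
  set v : ℝ := 4 * P ^ 2 * G ^ α with hv
  have hlv : l ^ 2 * v = G ^ α / (4 * T) := by
    rw [hl, hv, ← hs2]; field_simp
  have key : ∀ t, 1 ≤ t → t ≤ T → StronglyMeasurable[𝔉 t] (Y t) ∧
      (∀ᵐ ω ∂ℙ, 0 ≤ Y t ω) ∧ (∀ᵐ ω ∂ℙ, Y t ω ≤ 4 * τ ^ 2) ∧
      (∀ᵐ ω ∂ℙ, (ℙ[fun ω => Y t ω ^ 2 | 𝔉 (t - 1)]) ω ≤ v) := by
    intro t ht1 htT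
    have hYe : Y t = fun ω => ‖X t ω - (ℙ[X t | 𝔉 (t - 1)]) ω‖ ^ 2 := funext (hY t)
    have hXm : StronglyMeasurable[𝔉 t] (X t) := (hmeas t ht1 htT).stronglyMeasurable
    have hXa : AEStronglyMeasurable (X t) ℙ := (hXm.mono (h𝔉le t)).aestronglyMeasurable
    have hYm : StronglyMeasurable[𝔉 t] (Y t) := by
      rw [hYe]
      exact ((hXm.sub (stronglyMeasurable_condExp.mono (h𝔉mono (Nat.sub_le t 1)))).norm).pow 2
    have hYa : AEStronglyMeasurable (Y t) ℙ := (hYm.mono (h𝔉le t)).aestronglyMeasurable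
    have hb := hbdd t ht1 htT
    have hY0 : ∀ ω, 0 ≤ Y t ω := fun ω => by rw [hY]; positivity
    have hYB : ∀ᵐ ω ∂ℙ, Y t ω ≤ 4 * τ ^ 2 := by
      filter_upwards [hb, ae_bdd_norm_condExp_of_ae_bdd_norm (m := 𝔉 (t - 1)) hb] with ω h1 h2
      rw [hY]
      have h3 := norm_sub_le (X t ω) ((ℙ[X t | 𝔉 (t - 1)]) ω)
      nlinarith [norm_nonneg (X t ω - (ℙ[X t | 𝔉 (t - 1)]) ω)]
    refine ⟨hYm, ae_of_all _ hY0, hYB, ?_⟩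
    have iY : Integrable (Y t) ℙ := by
      refine aux_int ℙ hYa (4 * τ ^ 2) ?_
      filter_upwards [hYB] with ω h
      rwa [Real.norm_of_nonneg (hY0 ω)]
    have iY2 : Integrable (fun ω => Y t ω ^ 2) ℙ := by
      refine aux_int ℙ (hYa.pow 2) ((4 * τ ^ 2) ^ 2) ?_
      filter_upwards [hYB] with ω h
      rw [Real.norm_of_nonneg (by positivity)]
      exact pow_le_pow_left₀ (hY0 ω) h 2
    have iX2 : Integrable (fun ω => ‖X t ω‖ ^ 2) ℙ := by
      refine aux_int ℙ (hXa.norm.pow 2) (τ ^ 2) ?_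
      filter_upwards [hb] with ω h
      rw [Real.norm_of_nonneg (by positivity)]
      gcongr
    have iXα : Integrable (fun ω => ‖X t ω‖ ^ α) ℙ := by
      refine aux_int ℙ ((Real.continuous_rpow_const (by linarith)).comp_aestronglyMeasurable
        hXa.norm) (τ ^ α) ?_
      filter_upwards [hb] with ω h
      rw [Real.norm_of_nonneg (by positivity)]
      exact Real.rpow_le_rpow (norm_nonneg _) h (by linarith)
    have q1 := condExp_mono (m := 𝔉 (t - 1)) iY2 (iY.smul (4 * τ ^ 2)) (by
      filter_upwards [hYB] with ω h
      simp only [Pi.smul_apply, smul_eq_mul]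
      nlinarith [hY0 ω])
    have q2 := aux_vec ℙ d (𝔉 (t - 1)) (h𝔉le _) (X t) τ hXa hb
    rw [← hYe] at q2
    have q3 := condExp_mono (m := 𝔉 (t - 1)) iX2 (iXα.smul (τ ^ (2 - α))) (by
      filter_upwards [hb] with ω h
      simp only [Pi.smul_apply, smul_eq_mul]
      rcases (norm_nonneg (X t ω)).eq_or_lt with h0 | h0
      · rw [← h0, Real.zero_rpow (by linarith)]; simp
      · have : ‖X t ω‖ ^ 2 = ‖X t ω‖ ^ (2 - α) * ‖X t ω‖ ^ α := by
          rw [← Real.rpow_add h0, ← Real.rpow_natCast]; norm_num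
        rw [this]
        gcongr)
    filter_upwards [q1, q2, q3, hmom t ht1 htT, condExp_smul (μ := ℙ) (4 * τ ^ 2) (Y t) (𝔉 (t - 1)),
      condExp_smul (μ := ℙ) (τ ^ (2 - α)) (fun ω => ‖X t ω‖ ^ α) (𝔉 (t - 1))]
      with ω g1 g2 g3 g4 g5 g6
    rw [g5] at g1
    rw [g6] at g3
    simp only [Pi.smul_apply, smul_eq_mul] at g1 g3
    have hτ2α : 0 < τ ^ (2 - α) := Real.rpow_pos_of_pos hτ _
    calc _ ≤ _ := g1
      _ ≤ 4 * τ ^ 2 * (τ ^ (2 - α) * G ^ α) := by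
          refine mul_le_mul_of_nonneg_left ?_ (by positivity)
          exact (g2.trans g3).trans (mul_le_mul_of_nonneg_left g4 hτ2α.le)
      _ = v := by rw [hv, ← hP2]; ring
  have keyE : ∀ t, 1 ≤ t → t ≤ T → _ := fun t h1 h2 =>
    aux_exp ℙ (𝔉 (t - 1)) (h𝔉le _) (Y t) (4 * τ ^ 2) l v hl0.le hlB
      (((key t h1 h2).1.mono (h𝔉le t)).aestronglyMeasurable) (key t h1 h2).2.1
      (key t h1 h2).2.2.1 (key t h1 h2).2.2.2
  obtain ⟨-, -, hint, hmgf⟩ := aux_ind ℙ 𝔉 h𝔉mono h𝔉le T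
    (fun t ω => Y t ω - (ℙ[Y t | 𝔉 (t - 1)]) ω) l (4 * τ ^ 2) (l ^ 2 * v) hl0.le
    (fun t h1 h2 => (key t h1 h2).1.sub
      (stronglyMeasurable_condExp.mono (h𝔉mono (Nat.sub_le t 1))))
    (fun t h1 h2 => (keyE t h1 h2).1) (fun t h1 h2 => (keyE t h1 h2).2) T le_rfl
  set S : Ω → ℝ := fun ω => ∑ t ∈ Finset.Icc 1 T, (Y t ω - (ℙ[Y t | 𝔉 (t - 1)]) ω) with hS
  set ε : ℝ := s * P * G ^ α + 4 * s * P * Real.log (1 / δ) with hε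
  have hch := ProbabilityTheory.measure_ge_le_exp_mul_mgf (μ := ℙ) (X := S) (t := l) ε hl0.le hint
  have hlε : -l * ε + T * (l ^ 2 * v) = Real.log δ := by
    rw [hlv, hl, hε, one_div δ, Real.log_inv]; field_simp; ring
  have hfin : ℙ.real {ω | ε ≤ S ω} ≤ δ := by
    refine hch.trans ?_
    calc _ ≤ Real.exp (-l * ε) * Real.exp (T * (l ^ 2 * v)) :=
          mul_le_mul_of_nonneg_left hmgf (Real.exp_pos _).le
      _ = δ := by rw [← Real.exp_add, hlε, Real.exp_log hδ0]
  have hun : (1 : ENNReal) ≤ ℙ {ω | S ω ≤ ε} + ℙ {ω | ε ≤ S ω} := by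
    rw [← measure_univ (μ := ℙ)]
    refine (measure_mono ?_).trans (measure_union_le _ _)
    intro ω _
    exact le_total (S ω) ε
  have hfin' : ℙ {ω | ε ≤ S ω} ≤ ENNReal.ofReal δ := by
    rw [← ofReal_measureReal]
    exact ENNReal.ofReal_le_ofReal hfin
  rw [ENNReal.ofReal_sub _ hδ0.le, ENNReal.ofReal_one]
  exact tsub_le_iff_right.2 (hun.trans (by gcongr))
end

section
/- Let (Ω, 𝔉, ℙ) be a probability space with a filtration (𝔉_k)_{k≥0}, let α ∈ (1,2], G > 0, τ > 0, and let t be a positive integer. Let X_1,…,X_t be random vectors in ℝ^d such that X_k is 𝔉_k-measurable, ‖X_k‖ ≤ τ almost surely, and E[‖X_k‖^α | 𝔉_{k−1}] ≤ G^α almost surely for every k. Then for every δ ∈ (0,1), with probability at least 1 − δ, max_{1 ≤ j ≤ t} ‖Σ_{k=1}^j (X_k − E[X_k | 𝔉_{k−1}])‖ ≤ 2·(2τ/3 + t^{1/2}·G^{α/2}·τ^{(2−α)/2})·log(2/δ), where ‖·‖ is the Euclidean norm. -/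
open MeasureTheory

theorem aux_cosh_chord (p q u : ℝ) (r : ℝ) (hr : r ^ 2 = (1 + u) / 2 * p ^ 2 + (1 - u) / 2 * q ^ 2)
    (hu1 : -1 ≤ u) (hu2 : u ≤ 1) :
    Real.cosh r ≤ (1 + u) / 2 * Real.cosh p + (1 - u) / 2 * Real.cosh q := by
  have h1 := Real.hasSum_cosh r
  have h2 := ((Real.hasSum_cosh p).mul_left ((1 + u) / 2)).add
    ((Real.hasSum_cosh q).mul_left ((1 - u) / 2))
  refine hasSum_le (fun n => ?_) h1 h2
  have hc := (convexOn_pow (𝕜 := ℝ) n).2 (Set.mem_Ici.2 (sq_nonneg p)) (Set.mem_Ici.2 (sq_nonneg q))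
    (by linarith : 0 ≤ (1 + u) / 2) (by linarith : 0 ≤ (1 - u) / 2) (by ring)
  simp only [smul_eq_mul] at hc
  rw [← hr] at hc
  rw [pow_mul, pow_mul, pow_mul, ← mul_div_assoc, ← mul_div_assoc, ← add_div]
  gcongr

theorem aux_self_le_sinh {b : ℝ} (hb : 0 ≤ b) : b ≤ Real.sinh b := Real.self_le_sinh_iff.2 hb

theorem aux_upper {E : Type*} [NormedAddCommGroup E] [InnerProductSpace ℝ E] (x d : E) :
    Real.cosh ‖x + d‖ ≤ Real.cosh ‖x‖ * (Real.exp ‖d‖ - ‖d‖)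
      + inner ℝ ((Real.sinh ‖x‖ / ‖x‖) • x) d := by
  have hd := norm_nonneg d
  have hx := norm_nonneg x
  have key : ∃ u : ℝ, -1 ≤ u ∧ u ≤ 1 ∧ inner ℝ x d = ‖x‖ * ‖d‖ * u := by
    refine ⟨inner ℝ x d / (‖x‖ * ‖d‖), ?_, ?_, ?_⟩
    · exact (abs_le.1 (abs_real_inner_div_norm_mul_norm_le_one x d)).1
    · exact (abs_le.1 (abs_real_inner_div_norm_mul_norm_le_one x d)).2
    · by_cases h : ‖x‖ * ‖d‖ = 0
      · rcases mul_eq_zero.1 h with h | h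
        · simp [norm_eq_zero.1 h]
        · simp [norm_eq_zero.1 h]
      · rw [mul_comm, div_mul_cancel₀ _ h]
  obtain ⟨u, hu1, hu2, hu⟩ := key
  have hchord := aux_cosh_chord (‖x‖ + ‖d‖) (‖x‖ - ‖d‖) u ‖x + d‖
    (by rw [norm_add_sq_real, hu]; ring) hu1 hu2
  rw [Real.cosh_add, Real.cosh_sub] at hchord
  have h1 : inner ℝ ((Real.sinh ‖x‖ / ‖x‖) • x) d = Real.sinh ‖x‖ * ‖d‖ * u := by
    rw [real_inner_smul_left, hu]
    by_cases h : ‖x‖ = 0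
    · simp [h]
    · field_simp
  rw [h1, ← Real.cosh_add_sinh ‖d‖]
  have h2 := aux_self_le_sinh hd
  have h3 : Real.sinh ‖x‖ ≤ Real.cosh ‖x‖ := (Real.sinh_lt_cosh _).le
  have h4 : 0 ≤ Real.sinh ‖x‖ := Real.sinh_nonneg_iff.2 hx
  have h5 : Real.sinh ‖x‖ * u * (Real.sinh ‖d‖ - ‖d‖) ≤ Real.cosh ‖x‖ * (Real.sinh ‖d‖ - ‖d‖) := by
    apply mul_le_mul_of_nonneg_right _ (by linarith)
    nlinarith
  nlinarith

theorem aux_tangent (a b : ℝ) : Real.cosh a + Real.sinh a * (b - a) ≤ Real.cosh b := by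
  have h1 := Real.add_one_le_exp (b - a)
  have h2 := Real.add_one_le_exp (a - b)
  have e1 : Real.exp b = Real.exp a * Real.exp (b - a) := by rw [← Real.exp_add]; ring_nf
  have e2 : Real.exp (-b) = Real.exp (-a) * Real.exp (a - b) := by rw [← Real.exp_add]; ring_nf
  rw [Real.cosh_eq, Real.sinh_eq, Real.cosh_eq, e1, e2]
  nlinarith [mul_le_mul_of_nonneg_left h1 (Real.exp_pos a).le,
    mul_le_mul_of_nonneg_left h2 (Real.exp_pos (-a)).le]

theorem aux_lower {E : Type*} [NormedAddCommGroup E] [InnerProductSpace ℝ E] (x d : E) :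
    Real.cosh ‖x‖ + inner ℝ ((Real.sinh ‖x‖ / ‖x‖) • x) d ≤ Real.cosh ‖x + d‖ := by
  refine le_trans ?_ (aux_tangent ‖x‖ ‖x + d‖)
  gcongr
  rw [real_inner_smul_left]
  by_cases h : ‖x‖ = 0
  · simp [h]
  have hx : 0 < ‖x‖ := lt_of_le_of_ne (norm_nonneg x) (Ne.symm h)
  have h4 : 0 ≤ Real.sinh ‖x‖ := Real.sinh_nonneg_iff.2 hx.le
  rw [div_mul_eq_mul_div, mul_div_assoc]
  apply mul_le_mul_of_nonneg_left _ h4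
  rw [div_le_iff₀ hx]
  have := real_inner_le_norm x (x + d)
  rw [inner_add_right, real_inner_self_eq_norm_sq] at this
  nlinarith

theorem aux_exp_s18 {b B : ℝ} (hb : 0 ≤ b) (hbB : b ≤ B) (hB : B < 3) :
    Real.exp b - b ≤ 1 + b ^ 2 * (1 / (2 * (1 - B / 3))) := by
  have h1 : HasSum (fun n : ℕ => b ^ n / (n.factorial : ℝ)) (Real.exp b) := by
    rw [Real.exp_eq_exp_ℝ]; exact NormedSpace.expSeries_div_hasSum_exp b
  have h2 := (hasSum_nat_add_iff' 2).2 h1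
  have h3 := (hasSum_geometric_of_lt_one (by positivity : 0 ≤ b / 3) (by linarith)).mul_left (b ^ 2 / 2)
  have h4 := hasSum_le (fun n => ?_) h2 h3
  · simp [Finset.sum_range_succ] at h4
    have h5 : (1 - b / 3)⁻¹ ≤ (1 - B / 3)⁻¹ := by
      apply inv_anti₀ <;> linarith
    have h6 : b ^ 2 / 2 * (1 - b / 3)⁻¹ ≤ b ^ 2 / 2 * (1 - B / 3)⁻¹ := by gcongr
    have h7 : b ^ 2 * (1 / (2 * (1 - B / 3))) = b ^ 2 / 2 * (1 - B / 3)⁻¹ := by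
      rw [one_div, mul_inv]; ring
    rw [h7]; linarith
  · have hf : (2 * 3 ^ n : ℝ) ≤ ((n + 2).factorial : ℝ) := by
      have := Nat.factorial_mul_pow_le_factorial (m := 2) (n := n)
      have h := this
      rw [add_comm 2 n] at h
      exact_mod_cast h
    rw [show b ^ 2 / 2 * (b / 3) ^ n = b ^ (n + 2) / (2 * 3 ^ n) by rw [div_pow]; field_simp; ring]
    gcongr

theorem aux_int_bdd {Ω E : Type*} [NormedAddCommGroup E] {m : MeasurableSpace Ω} (μ : Measure Ω)
    [IsFiniteMeasure μ] {f : Ω → E} (hf : StronglyMeasurable f) (c : ℝ) (h : ∀ᵐ ω ∂μ, ‖f ω‖ ≤ c) :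
    Integrable f μ := Integrable.of_bound hf.aestronglyMeasurable c h

theorem aux_max {Ω E : Type*} [NormedAddCommGroup E] [InnerProductSpace ℝ E]
    {m : MeasurableSpace Ω} (μ : Measure Ω) [IsProbabilityMeasure μ]
    (ℱ : Filtration ℕ m) (Y : ℕ → Ω → E) (B s : ℝ)
    (hY : ∀ k, StronglyMeasurable[ℱ (k + 1)] (Y k))
    (hB0 : 0 ≤ B) (hB3 : B < 3) (hB : ∀ k, ∀ᵐ ω ∂μ, ‖Y k ω‖ ≤ B)
    (h0 : ∀ k (V : Ω → E) (c : ℝ), StronglyMeasurable[ℱ k] V → (∀ᵐ ω ∂μ, ‖V ω‖ ≤ c) →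
      ∫ ω, inner ℝ (V ω) (Y k ω) ∂μ = 0)
    (h2 : ∀ k (W : Ω → ℝ) (c : ℝ), StronglyMeasurable[ℱ k] W → (∀ ω, 0 ≤ W ω) →
      (∀ᵐ ω ∂μ, W ω ≤ c) → ∫ ω, W ω * ‖Y k ω‖ ^ 2 ∂μ ≤ s * ∫ ω, W ω ∂μ)
    (n : ℕ) (hs : 0 ≤ s) (ε : ℝ) (hε : 0 < ε) :
    μ {ω | ∃ j ≤ n, ε ≤ Real.cosh ‖∑ k ∈ Finset.range j, Y k ω‖}
      ≤ ENNReal.ofReal ((1 + s * (1 / (2 * (1 - B / 3)))) ^ n / ε) := by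
  set K := 1 / (2 * (1 - B / 3)) with hK
  have hK0 : 0 ≤ K := by rw [hK]; apply div_nonneg <;> linarith
  let S : ℕ → Ω → E := fun n ω => ∑ k ∈ Finset.range n, Y k ω
  let f : ℕ → Ω → ℝ := fun n ω => Real.cosh ‖S n ω‖
  have hSm : ∀ n, StronglyMeasurable[ℱ n] (S n) := by
    intro n
    refine Finset.stronglyMeasurable_fun_sum _ fun k hk => ?_
    exact (hY k).mono (ℱ.mono (Finset.mem_range.1 hk))
  have hSb : ∀ n, ∀ᵐ ω ∂μ, ‖S n ω‖ ≤ n * B := by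
    intro n
    filter_upwards [ae_all_iff.2 hB] with ω hω
    calc ‖S n ω‖ ≤ ∑ k ∈ Finset.range n, ‖Y k ω‖ := norm_sum_le _ _
      _ ≤ ∑ k ∈ Finset.range n, B := Finset.sum_le_sum fun k _ => hω k
      _ = n * B := by simp
  have hfm : ∀ n, StronglyMeasurable[ℱ n] (f n) := fun n =>
    Real.continuous_cosh.comp_stronglyMeasurable (hSm n).norm
  have hfb : ∀ n, ∀ᵐ ω ∂μ, f n ω ≤ Real.cosh (n * B) := by
    intro n
    filter_upwards [hSb n] with ω hω
    apply Real.cosh_le_cosh.2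
    rw [abs_of_nonneg (norm_nonneg _), abs_of_nonneg (by positivity)]
    exact hω
  have hf0 : ∀ n ω, 0 ≤ f n ω := fun n ω => (Real.cosh_pos _).le
  have hfi : ∀ n, Integrable (f n) μ := fun n => by
    refine aux_int_bdd μ ((hfm n).mono (ℱ.le n)) (Real.cosh (n * B)) ?_
    filter_upwards [hfb n] with ω hω
    rw [Real.norm_of_nonneg (hf0 n ω)]; exact hω
  let V : ℕ → Ω → E := fun n ω => (Real.sinh ‖S n ω‖ / ‖S n ω‖) • S n ω
  have hVm : ∀ n, StronglyMeasurable[ℱ n] (V n) := fun n => by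
    refine StronglyMeasurable.smul ?_ (hSm n)
    have h1 := (Real.continuous_sinh.comp_stronglyMeasurable (hSm n).norm)
    exact (h1.measurable.div (hSm n).norm.measurable).stronglyMeasurable
  have hVb : ∀ n, ∀ᵐ ω ∂μ, ‖V n ω‖ ≤ Real.cosh (n * B) := fun n => by
    filter_upwards [hfb n] with ω hω
    refine le_trans ?_ hω
    simp only [V, norm_smul, norm_div, norm_norm]
    have h4 : 0 ≤ Real.sinh ‖S n ω‖ := Real.sinh_nonneg_iff.2 (norm_nonneg _)
    rw [Real.norm_of_nonneg h4]
    have h5 := (Real.sinh_lt_cosh ‖S n ω‖).le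
    by_cases h : ‖S n ω‖ = 0
    · rw [h]; simp; exact hf0 n ω
    · rw [div_mul_cancel₀ _ h]; exact h5
  have hYm : ∀ k, StronglyMeasurable (Y k) := fun k => (hY k).mono (ℱ.le _)
  have hVYi : ∀ n (U : Ω → E) (c : ℝ), StronglyMeasurable U → (∀ᵐ ω ∂μ, ‖U ω‖ ≤ c) →
      Integrable (fun ω => inner ℝ (U ω) (Y n ω)) μ := by
    intro n U c hU hc
    refine aux_int_bdd μ (hU.inner (hYm n)) (c * B) ?_
    filter_upwards [hc, hB n] with ω h1 h2
    refine (norm_inner_le_norm _ _).trans ?_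
    exact mul_le_mul h1 h2 (norm_nonneg _) ((norm_nonneg _).trans h1)
  have hstep : ∀ n ω, S (n + 1) ω = S n ω + Y n ω := fun n ω => Finset.sum_range_succ _ _
  have hsub : Submartingale f ℱ μ := by
    refine submartingale_of_setIntegral_le_succ hfm hfi fun i A hA => ?_
    have hA' := ℱ.le i A hA
    have hz := h0 i (A.indicator (V i)) (Real.cosh (i * B)) ((hVm i).indicator hA) (by
      filter_upwards [hVb i] with ω hω
      exact (norm_indicator_le_norm_self _ _).trans hω)
    have hz' : ∫ ω in A, inner ℝ (V i ω) (Y i ω) ∂μ = 0 := by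
      rw [← integral_indicator hA', ← hz]
      congr 1; ext ω
      by_cases h : ω ∈ A <;> simp [h]
    have hi := (hVYi i (V i) _ ((hVm i).mono (ℱ.le i)) (hVb i)).integrableOn (s := A)
    calc ∫ ω in A, f i ω ∂μ = ∫ ω in A, (f i ω + inner ℝ (V i ω) (Y i ω)) ∂μ := by
          rw [integral_add (hfi i).integrableOn hi, hz', add_zero]
      _ ≤ _ := by
          refine integral_mono ((hfi i).integrableOn.add hi) (hfi (i + 1)).integrableOn fun ω => ?_
          simp only [f, hstep]
          exact aux_lower _ _
  have hgrow : ∀ n, ∫ ω, f n ω ∂μ ≤ (1 + s * K) ^ n := by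
    intro n
    induction n with
    | zero => simp [f, S]
    | succ i ih =>
      have hz := h0 i (V i) _ (hVm i) (hVb i)
      have hi := hVYi i (V i) _ ((hVm i).mono (ℱ.le i)) (hVb i)
      have hq := h2 i (f i) _ (hfm i) (hf0 i) (hfb i)
      have hqi : Integrable (fun ω => f i ω * ‖Y i ω‖ ^ 2) μ := by
        refine aux_int_bdd μ (((hfm i).mono (ℱ.le i)).mul ((hYm i).norm.pow 2))
          (Real.cosh (i * B) * B ^ 2) ?_
        filter_upwards [hfb i, hB i] with ω h1 h2
        rw [Real.norm_of_nonneg (mul_nonneg (hf0 i ω) (sq_nonneg _))]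
        have := (hf0 i ω)
        gcongr
      have hle : ∫ ω, f (i + 1) ω ∂μ ≤
          ∫ ω, (f i ω + K * (f i ω * ‖Y i ω‖ ^ 2) + inner ℝ (V i ω) (Y i ω)) ∂μ := by
        refine integral_mono_ae (hfi _) (((hfi i).add (hqi.const_mul K)).add hi) ?_
        filter_upwards [hB i] with ω hω
        have h1 := aux_upper (S i ω) (Y i ω)
        have h2 := aux_exp_s18 (norm_nonneg (Y i ω)) hω hB3
        have h3 := mul_le_mul_of_nonneg_left h2 (hf0 i ω)
        simp only [f, hstep] at h3 ⊢
        simp only [V]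
        rw [← hK] at h3
        linarith
      have hfk : Integrable (fun ω => f i ω + K * (f i ω * ‖Y i ω‖ ^ 2)) μ :=
        (hfi i).add (hqi.const_mul K)
      rw [integral_add hfk hi, integral_add (hfi i) (hqi.const_mul K),
        integral_const_mul, hz] at hle
      calc _ ≤ _ := hle
        _ ≤ (1 + s * K) * ∫ ω, f i ω ∂μ := by nlinarith
        _ ≤ (1 + s * K) * (1 + s * K) ^ i := by gcongr
        _ = _ := by ring
  have hmax := maximal_ineq hsub (fun n ω => hf0 n ω) (ε := ⟨ε, hε.le⟩) n
  set bad := {ω | ((⟨ε, hε.le⟩ : NNReal) : ℝ) ≤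
    (Finset.range (n + 1)).sup' Finset.nonempty_range_add_one fun k => f k ω} with hbad
  have heq : {ω | ∃ j ≤ n, ε ≤ Real.cosh ‖∑ k ∈ Finset.range j, Y k ω‖} = bad := by
    ext ω
    simp only [hbad, Set.mem_ofPred_eq, Finset.le_sup'_iff, Finset.mem_range, Nat.lt_succ_iff]
    rfl
  rw [heq, ENNReal.ofReal_div_of_pos hε, ENNReal.le_div_iff_mul_le
    (Or.inl (by simpa using hε)) (Or.inl ENNReal.ofReal_ne_top), mul_comm]
  have e : ENNReal.ofReal ε = ENNReal.ofNNReal (⟨ε, hε.le⟩ : NNReal) := by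
    rw [ENNReal.ofReal, Real.toNNReal_of_nonneg hε.le]; rfl
  rw [e]
  refine hmax.trans (ENNReal.ofReal_le_ofReal ?_)
  refine le_trans ?_ (hgrow n)
  exact setIntegral_le_integral (hfi n) (Filter.Eventually.of_forall (hf0 n))

theorem aux_orth {Ω E : Type*} [NormedAddCommGroup E] [InnerProductSpace ℝ E] [CompleteSpace E]
    {F m : MeasurableSpace Ω} (μ : Measure Ω) [IsProbabilityMeasure μ] (hF : F ≤ m)
    (X V : Ω → E) (τ c : ℝ) (hX : StronglyMeasurable X) (hXb : ∀ᵐ ω ∂μ, ‖X ω‖ ≤ τ)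
    (hV : StronglyMeasurable[F] V) (hVb : ∀ᵐ ω ∂μ, ‖V ω‖ ≤ c) :
    Integrable (fun ω => inner ℝ (V ω) (X ω - (μ[X | F]) ω)) μ ∧
    ∫ ω, inner ℝ (V ω) (X ω - (μ[X | F]) ω) ∂μ = 0 := by
  have hXi := aux_int_bdd μ hX τ hXb
  have h := condExp_stronglyMeasurable_bilin_of_bound (innerSL ℝ (E := E)) hF hV hXi c hVb
  have i1 : Integrable (fun ω => inner ℝ (V ω) (X ω)) μ :=
    (innerSL ℝ (E := E)).integrable_of_bilin_of_bdd_left c (hV.mono hF).aestronglyMeasurable hVb hXi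
  have i2 : Integrable (fun ω => inner ℝ (V ω) ((μ[X | F]) ω)) μ :=
    (innerSL ℝ (E := E)).integrable_of_bilin_of_bdd_left c (hV.mono hF).aestronglyMeasurable hVb
      integrable_condExp
  simp only [inner_sub_right]
  refine ⟨i1.sub i2, ?_⟩
  rw [integral_sub i1 i2, sub_eq_zero, ← integral_condExp hF]
  exact integral_congr_ae h

theorem aux_var {Ω E : Type*} [NormedAddCommGroup E] [InnerProductSpace ℝ E] [CompleteSpace E]
    {F m : MeasurableSpace Ω} (μ : Measure Ω) [IsProbabilityMeasure μ] (hF : F ≤ m)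
    (X : Ω → E) (W : Ω → ℝ) (τ α g c : ℝ) (hα1 : 1 < α) (hα2 : α ≤ 2) (hτ : 0 < τ)
    (hX : StronglyMeasurable X) (hXb : ∀ᵐ ω ∂μ, ‖X ω‖ ≤ τ)
    (hmom : ∀ᵐ ω ∂μ, (μ[fun ω' => ‖X ω'‖ ^ α | F]) ω ≤ g)
    (hW : StronglyMeasurable[F] W) (hW0 : ∀ ω, 0 ≤ W ω) (hWb : ∀ᵐ ω ∂μ, W ω ≤ c) :
    ∫ ω, W ω * ‖X ω - (μ[X | F]) ω‖ ^ 2 ∂μ ≤ (τ ^ (2 - α) * g) * ∫ ω, W ω ∂μ := by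
  have hmb := ae_bdd_norm_condExp_of_ae_bdd_norm (m := F) hXb
  have hMm : StronglyMeasurable[F] (μ[X | F]) := stronglyMeasurable_condExp
  have hWn : ∀ᵐ ω ∂μ, ‖W ω‖ ≤ c := by
    filter_upwards [hWb] with ω h
    rwa [Real.norm_of_nonneg (hW0 ω)]
  have hWi := aux_int_bdd μ (hW.mono hF) c hWn
  have hpm : StronglyMeasurable (fun ω => ‖X ω‖ ^ α) :=
    (Real.continuous_rpow_const (by linarith)).comp_stronglyMeasurable hX.norm
  have hpi : Integrable (fun ω => ‖X ω‖ ^ α) μ := by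
    refine aux_int_bdd μ hpm (τ ^ α) ?_
    filter_upwards [hXb] with ω h
    rw [Real.norm_of_nonneg (by positivity)]
    exact Real.rpow_le_rpow (norm_nonneg _) h (by linarith)
  have hWp : Integrable (fun ω => W ω * ‖X ω‖ ^ α) μ :=
    hpi.bdd_mul (hW.mono hF).aestronglyMeasurable hWn
  have ho := aux_orth μ hF X (fun ω => W ω • (μ[X | F]) ω) τ (c * τ) hX hXb (hW.smul hMm) (by
    filter_upwards [hWn, hmb] with ω h1 h2
    rw [norm_smul]
    exact mul_le_mul h1 h2 (norm_nonneg _) ((norm_nonneg _).trans h1))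
  have hlhs : Integrable (fun ω => W ω * ‖X ω - (μ[X | F]) ω‖ ^ 2) μ := by
    refine aux_int_bdd μ ((hW.mono hF).mul ((hX.sub (hMm.mono hF)).norm.pow 2))
      (c * (τ + τ) ^ 2) ?_
    filter_upwards [hWb, hmb, hXb] with ω h1 h2 h3
    rw [Real.norm_of_nonneg (mul_nonneg (hW0 ω) (sq_nonneg _))]
    have h4 : ‖X ω - (μ[X | F]) ω‖ ≤ τ + τ := (norm_sub_le _ _).trans (add_le_add h3 h2)
    have := hW0 ω
    have : 0 ≤ c := this.trans h1
    gcongr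
  have hce := condExp_mul_of_stronglyMeasurable_left (μ := μ) hW hWp hpi
  calc ∫ ω, W ω * ‖X ω - (μ[X | F]) ω‖ ^ 2 ∂μ
      ≤ ∫ ω, (τ ^ (2 - α) * (W ω * ‖X ω‖ ^ α)
        - 2 * inner ℝ (W ω • (μ[X | F]) ω) (X ω - (μ[X | F]) ω)) ∂μ := by
        refine integral_mono_ae hlhs ((hWp.const_mul _).sub (ho.1.const_mul 2)) ?_
        filter_upwards [hXb] with ω h
        have e1 : ‖X ω‖ ^ 2 = ‖X ω - (μ[X | F]) ω‖ ^ 2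
            + 2 * inner ℝ ((μ[X | F]) ω) (X ω - (μ[X | F]) ω) + ‖(μ[X | F]) ω‖ ^ 2 := by
          have := norm_add_sq_real ((μ[X | F]) ω) (X ω - (μ[X | F]) ω)
          rw [add_sub_cancel] at this
          linarith
        have e2 : ‖X ω‖ ^ 2 ≤ τ ^ (2 - α) * ‖X ω‖ ^ α := by
          rcases (norm_nonneg (X ω)).eq_or_lt with h0 | h0
          · rw [← h0, Real.zero_rpow (by linarith)]; simp
          · have : ‖X ω‖ ^ 2 = ‖X ω‖ ^ (2 - α) * ‖X ω‖ ^ α := by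
              rw [← Real.rpow_add h0]; norm_num
            rw [this]
            gcongr
        simp only [real_inner_smul_left]
        have h5 := mul_le_mul_of_nonneg_left e2 (hW0 ω)
        have h6 := mul_nonneg (hW0 ω) (sq_nonneg ‖(μ[X | F]) ω‖)
        rw [e1] at h5
        have e3 := e1
        nlinarith
    _ = τ ^ (2 - α) * ∫ ω, W ω * ‖X ω‖ ^ α ∂μ := by
        rw [integral_sub (hWp.const_mul _) (ho.1.const_mul 2), integral_const_mul,
          integral_const_mul, ho.2]; ring
    _ = τ ^ (2 - α) * ∫ ω, W ω * (μ[fun ω' => ‖X ω'‖ ^ α | F]) ω ∂μ := by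
        rw [← integral_condExp hF]
        congr 1
        exact integral_congr_ae hce
    _ ≤ τ ^ (2 - α) * ∫ ω, g * W ω ∂μ := by
        gcongr ?_ * ?_
        refine integral_mono_ae ?_ (hWi.const_mul g) ?_
        · exact integrable_condExp.bdd_mul (hW.mono hF).aestronglyMeasurable hWn
        · filter_upwards [hmom] with ω h
          have := hW0 ω
          nlinarith
    _ = _ := by rw [integral_const_mul]; ring

/-- **Maximal partial-sum bound for centered bounded random vectors with bounded conditional
`α`-th moments** (via the Pinelis–Bernstein inequality). If `‖X_k‖ ≤ τ` a.s. and
`E[‖X_k‖^α | 𝔉_{k-1}] ≤ G^α` a.s., then for every `δ ∈ (0,1)`, with probability at least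
`1 - δ`, `max_{1 ≤ j ≤ t} ‖∑_{k=1}^j (X_k - E[X_k | 𝔉_{k-1}])‖ ≤
2 (2τ/3 + t^{1/2} G^{α/2} τ^{(2-α)/2}) log(2/δ)`. -/
theorem stmt18 {Ω : Type*} {m : MeasurableSpace Ω} (ℙ : Measure Ω) [IsProbabilityMeasure ℙ]
    (d : ℕ) (𝔉 : ℕ → MeasurableSpace Ω) (h𝔉mono : Monotone 𝔉) (h𝔉le : ∀ k, 𝔉 k ≤ m)
    (α G τ : ℝ) (hα1 : 1 < α) (hα2 : α ≤ 2) (hG : 0 < G) (hτ : 0 < τ)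
    (t : ℕ) (ht : 0 < t)
    (X : ℕ → Ω → EuclideanSpace ℝ (Fin d))
    (hmeas : ∀ k, 1 ≤ k → k ≤ t → Measurable[𝔉 k] (X k))
    (hbdd : ∀ k, 1 ≤ k → k ≤ t → ∀ᵐ ω ∂ℙ, ‖X k ω‖ ≤ τ)
    (hmom : ∀ k, 1 ≤ k → k ≤ t →
      ∀ᵐ ω ∂ℙ, (ℙ[fun ω' => ‖X k ω'‖ ^ α | 𝔉 (k - 1)]) ω ≤ G ^ α)
    (δ : ℝ) (hδ : δ ∈ Set.Ioo (0 : ℝ) 1) :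
    ENNReal.ofReal (1 - δ) ≤
      ℙ {ω | ∀ j ∈ Finset.Icc 1 t,
        ‖∑ k ∈ Finset.Icc 1 j, (X k ω - (ℙ[X k | 𝔉 (k - 1)]) ω)‖ ≤
          2 * (2 * τ / 3 + (t : ℝ) ^ ((1 : ℝ) / 2) * G ^ (α / 2) * τ ^ ((2 - α) / 2))
            * Real.log (2 / δ)} := by
  obtain ⟨hδ0, hδ1⟩ := hδ
  set σ := (t : ℝ) ^ ((1 : ℝ) / 2) * G ^ (α / 2) * τ ^ ((2 - α) / 2) with hσ
  have ht' : (0 : ℝ) < t := by exact_mod_cast ht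
  have hσ0 : 0 < σ := by positivity
  have hσ2 : σ ^ 2 = t * (τ ^ (2 - α) * G ^ α) := by
    rw [hσ, mul_pow, mul_pow, ← Real.rpow_natCast, ← Real.rpow_natCast, ← Real.rpow_natCast,
      ← Real.rpow_mul ht'.le, ← Real.rpow_mul hG.le, ← Real.rpow_mul hτ.le]
    norm_num
    ring
  set L := Real.log (2 / δ) with hL
  have hL2 : 1 / 2 ≤ L := by
    have h1 : Real.log 2 ≤ L := by
      apply Real.log_le_log (by norm_num)
      rw [le_div_iff₀ hδ0]; linarith
    have := Real.log_two_gt_d9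
    linarith
  set l := 1 / (2 * τ / 3 + σ) with hl
  have hden : 0 < 2 * τ / 3 + σ := by positivity
  have hl0 : 0 < l := by positivity
  have hll : l * (2 * τ / 3 + σ) = 1 := by rw [hl]; field_simp
  let ℱ : Filtration ℕ m := ⟨𝔉, h𝔉mono, h𝔉le⟩
  let Y : ℕ → Ω → EuclideanSpace ℝ (Fin d) := fun k ω =>
    if k + 1 ≤ t then l • (X (k + 1) ω - (ℙ[X (k + 1) | 𝔉 k]) ω) else 0
  have hXm : ∀ k, k + 1 ≤ t → StronglyMeasurable[𝔉 (k + 1)] (X (k + 1)) := fun k hk =>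
    (hmeas (k + 1) (by omega) hk).stronglyMeasurable
  have hs0 : 0 ≤ l ^ 2 * (τ ^ (2 - α) * G ^ α) := by positivity
  have hmain := aux_max ℙ ℱ Y (l * (2 * τ)) (l ^ 2 * (τ ^ (2 - α) * G ^ α)) ?_ (by positivity)
    (by nlinarith) ?_ ?_ ?_ t hs0 (Real.exp (l * (2 * (2 * τ / 3 + σ) * L)) / 2)
    (by positivity)
  · set bad := {ω | ∃ j ≤ t, Real.exp (l * (2 * (2 * τ / 3 + σ) * L)) / 2 ≤
      Real.cosh ‖∑ k ∈ Finset.range j, Y k ω‖} with hbad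
    set good := {ω | ∀ j ∈ Finset.Icc 1 t,
        ‖∑ k ∈ Finset.Icc 1 j, (X k ω - (ℙ[X k | 𝔉 (k - 1)]) ω)‖ ≤
          2 * (2 * τ / 3 + σ) * L} with hgood
    have hb : ℙ bad ≤ ENNReal.ofReal δ := by
      refine hmain.trans (ENNReal.ofReal_le_ofReal ?_)
      have e1 : l * (2 * (2 * τ / 3 + σ) * L) = 2 * L := by
        linear_combination (2 * L) * hll
      have e2 : 1 - l * (2 * τ) / 3 = l * σ := by linear_combination -hll
      rw [e1, e2, div_div_eq_mul_div, div_le_iff₀ (Real.exp_pos _)]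
      set v := l ^ 2 * (τ ^ (2 - α) * G ^ α) * (1 / (2 * (l * σ))) with hv
      have hv0 : 0 ≤ v := by positivity
      have htv : t * v = l * σ / 2 := by
        have : t * v = l ^ 2 * σ ^ 2 * (1 / (2 * (l * σ))) := by rw [hσ2, hv]; ring
        rw [this]; field_simp
      have hp : (1 + v) ^ t ≤ Real.exp L := by
        calc (1 + v) ^ t ≤ (Real.exp v) ^ t := by
              gcongr; linarith [Real.add_one_le_exp v]
          _ = Real.exp (t * v) := by rw [← Real.exp_nat_mul]
          _ ≤ Real.exp L := by
              apply Real.exp_le_exp.2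
              rw [htv]
              have : l * σ ≤ 1 := by nlinarith [mul_pos hl0 hτ]
              linarith
      have e3 : Real.exp L = 2 / δ := by rw [hL, Real.exp_log (by positivity)]
      rw [two_mul L, Real.exp_add]
      calc (1 + v) ^ t * 2 ≤ Real.exp L * 2 := by gcongr
        _ = δ * (Real.exp L * Real.exp L) := by rw [e3]; field_simp
    have hcov : (Set.univ : Set Ω) ⊆ good ∪ bad := by
      intro ω _
      by_cases hω : ω ∈ bad
      · exact Or.inr hω
      left
      intro j hj
      rw [Finset.mem_Icc] at hj
      by_contra hcon
      apply hω
      refine ⟨j, hj.2, ?_⟩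
      push Not at hcon
      have e : ∑ k ∈ Finset.range j, Y k ω =
          l • ∑ k ∈ Finset.Icc 1 j, (X k ω - (ℙ[X k | 𝔉 (k - 1)]) ω) := by
        rw [Finset.smul_sum, Finset.range_eq_Ico]
        have h := Finset.sum_Ico_add' (fun k => l • (X k ω - (ℙ[X k | 𝔉 (k - 1)]) ω)) 0 j 1
        have hI : Finset.Ico (0 + 1) (j + 1) = Finset.Icc 1 j := by
          ext; simp only [Finset.mem_Ico, Finset.mem_Icc]; omega
        rw [hI] at h
        rw [← h]
        refine Finset.sum_congr rfl fun k hk => ?_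
        have hk' : k + 1 ≤ t := by have := (Finset.mem_Ico.1 hk).2; omega
        simp only [Y, if_pos hk', Nat.add_sub_cancel]
      rw [e, norm_smul, Real.norm_of_nonneg hl0.le, Real.cosh_eq]
      have h1 := Real.exp_le_exp.2 (mul_le_mul_of_nonneg_left hcon.le hl0.le)
      have h2 := Real.exp_pos
        (-(l * ‖∑ k ∈ Finset.Icc 1 j, (X k ω - (ℙ[X k | 𝔉 (k - 1)]) ω)‖))
      linarith
    have h1 : (1 : ENNReal) ≤ ℙ good + ENNReal.ofReal δ := by
      calc (1 : ENNReal) = ℙ Set.univ := measure_univ.symm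
        _ ≤ ℙ (good ∪ bad) := measure_mono hcov
        _ ≤ ℙ good + ℙ bad := measure_union_le _ _
        _ ≤ _ := by gcongr
    rw [ENNReal.ofReal_sub _ hδ0.le, ENNReal.ofReal_one]
    exact tsub_le_iff_right.2 h1
  · intro k
    by_cases hk : k + 1 ≤ t
    · simp only [Y, if_pos hk]
      have h1 : StronglyMeasurable[𝔉 (k + 1)] (ℙ[X (k + 1) | 𝔉 k]) :=
        stronglyMeasurable_condExp.mono (h𝔉mono (Nat.le_succ k))
      exact ((hXm k hk).sub h1).const_smul l
    · simp only [Y, if_neg hk]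
      exact stronglyMeasurable_const
  · intro k
    by_cases hk : k + 1 ≤ t
    · have hb := hbdd (k + 1) (by omega) hk
      filter_upwards [hb, ae_bdd_norm_condExp_of_ae_bdd_norm (m := 𝔉 k) hb] with ω h1 h2
      simp only [Y, if_pos hk]
      rw [norm_smul, Real.norm_of_nonneg hl0.le]
      gcongr
      linarith [norm_sub_le (X (k + 1) ω) ((ℙ[X (k + 1) | 𝔉 k]) ω)]
    · simp only [Y, if_neg hk, norm_zero]
      exact Filter.Eventually.of_forall fun _ => by positivity
  · intro k V c hV hVb
    by_cases hk : k + 1 ≤ t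
    · simp only [Y, if_pos hk, real_inner_smul_right]
      rw [integral_const_mul, (aux_orth ℙ (h𝔉le k) (X (k + 1)) V τ c
        ((hXm k hk).mono (h𝔉le _)) (hbdd (k + 1) (by omega) hk) hV hVb).2, mul_zero]
    · simp only [Y, if_neg hk, inner_zero_right, integral_zero]
  · intro k W c hW hW0 hWb
    by_cases hk : k + 1 ≤ t
    · simp only [Y, if_pos hk, norm_smul, Real.norm_of_nonneg hl0.le, mul_pow]
      have h := aux_var ℙ (h𝔉le k) (X (k + 1)) W τ α (G ^ α) c hα1 hα2 hτ
        ((hXm k hk).mono (h𝔉le _)) (hbdd (k + 1) (by omega) hk)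
        (hmom (k + 1) (by omega) hk) hW hW0 hWb
      simp only [mul_left_comm _ (l ^ 2)]
      rw [integral_const_mul, mul_assoc]
      gcongr
    · simp only [Y, if_neg hk]
      simp only [norm_zero, ne_eq, OfNat.ofNat_ne_zero, not_false_eq_true, zero_pow, mul_zero,
        integral_zero]
      exact mul_nonneg hs0 (integral_nonneg hW0)
end
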